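/- arXiv:1612.05381 — 3 statements merged into one kernel-verified Lean document; each statement's English description precedes it below -/
import Mathlib

section
/- Let G be a connected graph of order n > 3 with m edges. If G contains no triangle (G is K₃-free), then tmc(G) = m − n + 2 + l(G). -/
open SimpleGraph

/-- A walk in a total-colored graph is *total monochromatic* if all of its edges and
internal vertices have the same color. -/
def IsTotalMonoWalk {V : Type*} {G : SimpleGraph V} (ce : Sym2 V → ℕ) (cv : V → ℕ)
    {u v : V} (w : G.Walk u v) : Prop :=
  ∃ c, (∀ e ∈ w.edges, ce e = c) ∧ ∀ x ∈ w.support.tail.dropLast, cv x = c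

/-- A total coloring (edge coloring `ce`, vertex coloring `cv`) of `G` is a
*TMC-coloring* if any two vertices are connected by a total monochromatic path. -/
def IsTMCColoring {V : Type*} (G : SimpleGraph V) (ce : Sym2 V → ℕ) (cv : V → ℕ) : Prop :=
  ∀ u v : V, u ≠ v → ∃ w : G.Walk u v, w.IsPath ∧ IsTotalMonoWalk ce cv w

/-- The number of colors used by a total coloring of `G`:
colors appearing on edges of `G` together with colors appearing on vertices. -/
noncomputable def colorsUsed {V : Type*} (G : SimpleGraph V) (ce : Sym2 V → ℕ) (cv : V → ℕ) : ℕ :=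
  (ce '' G.edgeSet ∪ Set.range cv).ncard

/-- The total monochromatic connection number `tmc G`: the maximum number of colors
used in a TMC-coloring of `G`. -/
noncomputable def tmc {V : Type*} [Fintype V] (G : SimpleGraph V) : ℕ :=
  sSup {k | ∃ ce cv, IsTMCColoring G ce cv ∧ colorsUsed G ce cv = k}

/-- The number of leaves (vertices of degree one) of a graph. -/
noncomputable def numLeaves {V : Type*} (T : SimpleGraph V) : ℕ :=
  {v : V | (T.neighborSet v).ncard = 1}.ncard

/-- `maxLeaves G` is the maximum number of leaves over all spanning trees of `G`. -/
noncomputable def maxLeaves {V : Type*} [Fintype V] (G : SimpleGraph V) : ℕ :=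
  sSup {k | ∃ T : SimpleGraph V, T ≤ G ∧ T.IsTree ∧ numLeaves T = k}


open Classical in
/-- A connected core `K` together with a set `S` dominated by it. -/
structure GoodPair {V : Type*} (G : SimpleGraph V) (K S : Finset V) : Prop where
  sub : K ⊆ S
  conn : (G.induce (K : Set V)).Connected
  dom : ∀ y ∈ S, y ∈ K ∨ ∃ x ∈ K, G.Adj x y

lemma GoodPair.nonempty {V : Type*} {G : SimpleGraph V} {K S : Finset V} (h : GoodPair G K S) :
    K.Nonempty := by
  obtain ⟨x⟩ := h.conn.nonempty
  exact ⟨x.1, x.2⟩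

lemma leaves_bddAbove {V : Type*} [Fintype V] (G : SimpleGraph V) :
    BddAbove {k | ∃ T : SimpleGraph V, T ≤ G ∧ T.IsTree ∧ numLeaves T = k} := by
  refine ⟨Fintype.card V, ?_⟩
  rintro k ⟨T, -, -, rfl⟩
  unfold numLeaves
  rw [← Nat.card_eq_fintype_card]
  exact Set.ncard_le_card _

open Classical in
lemma leaves_of_dominating {V : Type*} [Fintype V] (G : SimpleGraph V)
    (hn : 3 < Fintype.card V) (K : Finset V) (h : GoodPair G K Finset.univ) :
    Fintype.card V ≤ maxLeaves G + K.card := by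
  have hdom : ∀ y, ∃ x, y ∉ K → x ∈ K ∧ G.Adj x y := by
    intro y
    by_cases hy : y ∈ K
    · exact ⟨y, fun h => absurd hy h⟩
    · rcases h.dom y (Finset.mem_univ _) with h1 | ⟨x, hx, hxy⟩
      · exact absurd h1 hy
      · exact ⟨x, fun _ => ⟨hx, hxy⟩⟩
  choose f hf using hdom
  let H : SimpleGraph V :=
    { Adj := fun x y => G.Adj x y ∧ ((x ∈ K ∧ y ∈ K) ∨ (x ∉ K ∧ y = f x) ∨ (y ∉ K ∧ x = f y))
      symm := ⟨by
        rintro x y ⟨h1, h2⟩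
        exact ⟨h1.symm, by tauto⟩⟩
      loopless := ⟨by
        rintro x ⟨h1, -⟩
        exact G.loopless.irrefl x h1⟩ }
  have hHG : H ≤ G := fun x y hxy => hxy.1
  have hKK : ∀ x ∈ K, ∀ y ∈ K, H.Reachable x y := by
    intro x hx y hy
    have := h.conn.preconnected ⟨x, by simpa using hx⟩ ⟨y, by simpa using hy⟩
    let φ : G.induce (K : Set V) →g H :=
      { toFun := fun z => z.1
        map_rel' := by
          rintro ⟨a, ha⟩ ⟨b, hb⟩ hab
          exact ⟨hab, Or.inl ⟨by simpa using ha, by simpa using hb⟩⟩ }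
    exact this.map φ
  obtain ⟨r, hr⟩ := h.nonempty
  have hroot : ∀ x, H.Reachable r x := by
    intro x
    by_cases hx : x ∈ K
    · exact hKK r hr x hx
    · have h1 := hf x hx
      refine (hKK r hr _ h1.1).trans (Adj.reachable ?_)
      exact ⟨h1.2, Or.inr (Or.inr ⟨hx, rfl⟩)⟩
  have hconn : H.Connected :=
    { preconnected := fun x y => (hroot x).symm.trans (hroot y)
      nonempty := ⟨r⟩ }
  obtain ⟨T, hTH, hT⟩ := hconn.exists_isTree_le
  have hle : numLeaves T ≤ maxLeaves G :=
    le_csSup (leaves_bddAbove G) ⟨T, hTH.trans hHG, hT, rfl⟩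
  have hleaf : ((Finset.univ \ K : Finset V) : Set V) ⊆
      {v : V | (T.neighborSet v).ncard = 1} := by
    intro x hx
    have hx : x ∉ K := by simpa using hx
    have : Nontrivial V := Fintype.one_lt_card_iff_nontrivial.1 (by omega)
    obtain ⟨y, hy⟩ := hT.connected.preconnected.exists_adj_of_nontrivial x
    have huniq : ∀ z, T.Adj x z → z = f x := by
      intro z hz
      have h2 := (hTH hz).2
      have h3 : z ∉ K → f z ∈ K := fun hz => (hf z hz).1
      rcases h2 with h2 | h2 | h2
      · exact absurd h2.1 hx
      · exact h2.2
      · exact absurd (h2.2 ▸ h3 h2.1) hx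
    show (T.neighborSet x).ncard = 1
    rw [Set.ncard_eq_one]
    refine ⟨f x, ?_⟩
    ext z
    simp only [mem_neighborSet, Set.mem_singleton_iff]
    exact ⟨huniq z, fun h => by rw [h, ← huniq y hy]; exact hy⟩
  have h1 := Set.ncard_le_ncard hleaf (Set.toFinite _)
  rw [Set.ncard_coe_finset] at h1
  have h2 := Finset.card_sdiff_add_card_eq_card (Finset.subset_univ K)
  rw [Finset.card_univ] at h2
  change _ ≤ numLeaves T at h1
  omega

open Classical in
lemma leaves_of_good {V : Type*} [Fintype V] (G : SimpleGraph V) (hG : G.Connected)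
    (hn : 3 < Fintype.card V) : ∀ (d : ℕ) (K S : Finset V), Fintype.card V - S.card = d →
    GoodPair G K S → S.card ≤ maxLeaves G + K.card := by
  intro d
  induction d using Nat.strong_induction_on with
  | _ d ih =>
  intro K S hd h
  by_cases hS : S = Finset.univ
  · subst hS
    simpa using leaves_of_dominating G hn K h
  · obtain ⟨w, hw⟩ : ∃ w, w ∉ S := by
      by_contra hc
      push Not at hc
      exact hS (Finset.eq_univ_of_forall hc)
    obtain ⟨r, hr⟩ := h.nonempty
    obtain ⟨p⟩ := hG.preconnected r w
    obtain ⟨e, -, he1, he2⟩ := p.exists_boundary_dart (S : Set V) (by simpa using h.sub hr)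
      (by simpa using hw)
    have hadj := e.adj
    set x := e.fst
    set y := e.snd
    simp only [Finset.mem_coe] at he1 he2
    have hlt : S.card < Fintype.card V := by
      rw [← Finset.card_univ]
      exact Finset.card_lt_card (Finset.ssubset_univ_iff.2 hS)
    have hcS : (insert y S).card = S.card + 1 := Finset.card_insert_of_notMem he2
    have hcK : (insert x K).card ≤ K.card + 1 := Finset.card_insert_le _ _
    have hgood : GoodPair G (insert x K) (insert y S) := by
      refine ⟨?_, ?_, ?_⟩
      · intro z hz
        rcases Finset.mem_insert.1 hz with rfl | hz
        · exact Finset.mem_insert_of_mem he1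
        · exact Finset.mem_insert_of_mem (h.sub hz)
      · rcases h.dom x he1 with hx | ⟨z, hz, hzx⟩
        · rw [Finset.insert_eq_of_mem hx]; exact h.conn
        · have := connected_induce_union (G := G) (v := x) (w := z) (s := {x}) (t := (K : Set V))
            (by simp [preconnected_top]) h.conn.preconnected (by simp) (by simpa using hz) hzx.symm
          rw [Finset.coe_insert, Set.insert_eq]
          exact this
      · intro z hz
        rcases Finset.mem_insert.1 hz with rfl | hz
        · exact Or.inr ⟨x, Finset.mem_insert_self _ _, hadj⟩
        · rcases h.dom z hz with h1 | ⟨a, ha, haz⟩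
          · exact Or.inl (Finset.mem_insert_of_mem h1)
          · exact Or.inr ⟨a, Finset.mem_insert_of_mem ha, haz⟩
    have := ih (Fintype.card V - (insert y S).card) (by omega) _ _ rfl hgood
    omega

open Classical in
lemma GoodPair.insert_conn {V : Type*} {G : SimpleGraph V} {K S : Finset V}
    (h : GoodPair G K S) {x : V} (hx : x ∈ S) :
    (G.induce ((insert x K : Finset V) : Set V)).Connected := by
  rcases h.dom x hx with hx | ⟨z, hz, hzx⟩
  · rw [Finset.insert_eq_of_mem hx]; exact h.conn
  · have := connected_induce_union (G := G) (v := x) (w := z) (s := {x}) (t := (K : Set V))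
      (by simp [preconnected_top]) h.conn.preconnected (by simp) (by simpa using hz) hzx.symm
    rw [Finset.coe_insert, Set.insert_eq]
    exact this

open Classical in
lemma GoodPair.merge {V : Type*} {G : SimpleGraph V} {K S K' S' : Finset V}
    (h : GoodPair G K S) (h' : GoodPair G K' S') {x : V} (hx : x ∈ S) (hx' : x ∈ S') :
    GoodPair G (insert x (K ∪ K')) (S ∪ S') := by
  refine ⟨?_, ?_, ?_⟩
  · intro z hz
    simp only [Finset.mem_insert, Finset.mem_union] at hz ⊢
    rcases hz with rfl | hz | hz
    · exact Or.inl hx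
    · exact Or.inl (h.sub hz)
    · exact Or.inr (h'.sub hz)
  · have := induce_union_connected (h.insert_conn hx).preconnected (h'.insert_conn hx').preconnected
      ⟨x, by simp⟩
    have he : ((insert x (K ∪ K') : Finset V) : Set V)
        = ((insert x K : Finset V) : Set V) ∪ ((insert x K' : Finset V) : Set V) := by
      ext z
      simp
      tauto
    rw [he]
    exact this
  · intro z hz
    simp only [Finset.mem_insert, Finset.mem_union] at hz ⊢
    rcases hz with hz | hz
    · rcases h.dom z hz with h1 | ⟨a, ha, haz⟩
      · tauto
      · exact Or.inr ⟨a, by tauto, haz⟩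
    · rcases h'.dom z hz with h1 | ⟨a, ha, haz⟩
      · tauto
      · exact Or.inr ⟨a, by tauto, haz⟩

open Classical in
lemma GoodPair.exists_nbr {V : Type*} {G : SimpleGraph V} {K S : Finset V}
    (h : GoodPair G K S) (h2 : 2 ≤ S.card) {x : V} (hx : x ∈ S) : ∃ y ∈ S, G.Adj x y := by
  rcases h.dom x hx with hxK | ⟨z, hz, hzx⟩
  · obtain ⟨y, hy, hyx⟩ : ∃ y ∈ S, y ≠ x := Finset.exists_mem_ne (by omega) x
    rcases h.dom y hy with hyK | ⟨z, hz, hzy⟩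
    · have : Nontrivial (K : Set V) := ⟨⟨⟨x, hxK⟩, ⟨y, hyK⟩, by
        intro hc
        exact hyx (congrArg Subtype.val hc).symm⟩⟩
      obtain ⟨w, hw⟩ := h.conn.preconnected.exists_adj_of_nontrivial ⟨x, hxK⟩
      exact ⟨w.1, h.sub w.2, hw⟩
    · by_cases hzx : z = x
      · subst hzx; exact ⟨y, hy, hzy⟩
      · have : Nontrivial (K : Set V) := ⟨⟨⟨x, hxK⟩, ⟨z, hz⟩, by
          intro hc
          exact hzx (congrArg Subtype.val hc).symm⟩⟩
        obtain ⟨w, hw⟩ := h.conn.preconnected.exists_adj_of_nontrivial ⟨x, hxK⟩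
        exact ⟨w.1, h.sub w.2, hw⟩
  · exact ⟨z, h.sub hz, hzx.symm⟩

/-- The cost of a pair. -/
def pcost {V : Type*} (p : Finset V × Finset V) : ℤ := (p.1.card : ℤ) + p.2.card - 2

open Classical in
/-- Number of non-neighbours of `u` covered by the pair. -/
noncomputable def pcov {V : Type*} (G : SimpleGraph V) (u : V) (p : Finset V × Finset V) : ℕ :=
  if u ∈ p.2 then (p.2.filter fun y => y ≠ u ∧ ¬ G.Adj u y).card else 0

open Classical in
lemma pcov_le {V : Type*} (G : SimpleGraph V) (u : V) (p : Finset V × Finset V)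
    (h : GoodPair G p.1 p.2) (h2 : 2 ≤ p.2.card) : pcov G u p + 2 ≤ p.2.card := by
  unfold pcov
  split_ifs with hu
  · obtain ⟨y, hy, huy⟩ := h.exists_nbr h2 hu
    have hsub : (p.2.filter fun y => y ≠ u ∧ ¬ G.Adj u y) ⊆ (p.2.erase u).erase y := by
      intro z hz
      simp only [Finset.mem_filter, Finset.mem_erase] at hz ⊢
      refine ⟨?_, hz.2.1, hz.1⟩
      rintro rfl
      exact hz.2.2 huy
    have := Finset.card_le_card hsub
    rw [Finset.card_erase_of_mem (Finset.mem_erase.2 ⟨huy.ne', hy⟩),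
      Finset.card_erase_of_mem hu] at this
    omega
  · omega

open Classical in
lemma edge_finish {V : Type*} [Fintype V] (G : SimpleGraph V) (hfree : G.CliqueFree 3) (L : ℤ)
    (hL : ∀ K S : Finset V, GoodPair G K S → (S.card : ℤ) ≤ L + K.card)
    (F : Finset (Finset V × Finset V))
    (hcov : ∀ u v, u ≠ v → ¬ G.Adj u v → ∃ p ∈ F, u ∈ p.2 ∧ v ∈ p.2)
    (u v : V) (huv : G.Adj u v)
    (hsum : 2 ≤ ∑ p ∈ F, (pcost p - pcov G u p - pcov G v p)) :
    2 * (Fintype.card V : ℤ) - 2 - L ≤ ∑ p ∈ F, pcost p := by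
  have hnn : ∀ u : V, Fintype.card V ≤ 1 + G.degree u + ∑ p ∈ F, pcov G u p := by
    intro u
    have hsub : (Finset.univ : Finset V) ⊆ (insert u (G.neighborFinset u)) ∪
        F.biUnion (fun p => if u ∈ p.2 then (p.2.filter fun y => y ≠ u ∧ ¬ G.Adj u y) else ∅) := by
      intro y _
      simp only [Finset.mem_union, Finset.mem_insert, mem_neighborFinset, Finset.mem_biUnion]
      by_cases h1 : y = u
      · tauto
      by_cases h2 : G.Adj u y
      · tauto
      obtain ⟨p, hp, hp1, hp2⟩ := hcov u y (Ne.symm h1) h2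
      refine Or.inr ⟨p, hp, ?_⟩
      rw [if_pos hp1]
      simp [hp2, h1, h2]
    have h1 := Finset.card_le_card hsub
    have h2 := Finset.card_union_le (insert u (G.neighborFinset u))
      (F.biUnion (fun p => if u ∈ p.2 then (p.2.filter fun y => y ≠ u ∧ ¬ G.Adj u y) else ∅))
    have h3 := Finset.card_insert_le u (G.neighborFinset u)
    have h4 := Finset.card_biUnion_le (s := F)
      (t := fun p => if u ∈ p.2 then (p.2.filter fun y => y ≠ u ∧ ¬ G.Adj u y) else ∅)
    have h5 : ∑ p ∈ F, (if u ∈ p.2 then (p.2.filter fun y => y ≠ u ∧ ¬ G.Adj u y) else ∅).card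
        = ∑ p ∈ F, pcov G u p := by
      refine Finset.sum_congr rfl fun p _ => ?_
      unfold pcov
      split_ifs <;> simp
    rw [Finset.card_univ] at h1
    rw [card_neighborFinset_eq_degree] at h3
    omega
  have hLuv : (G.degree u : ℤ) + G.degree v ≤ L + 2 := by
    have hg : GoodPair G {u, v} (G.neighborFinset u ∪ G.neighborFinset v) := by
      refine ⟨?_, ?_, ?_⟩
      · intro z hz
        simp only [Finset.mem_insert, Finset.mem_singleton] at hz
        simp only [Finset.mem_union, mem_neighborFinset]
        rcases hz with rfl | rfl
        · exact Or.inr huv.symm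
        · exact Or.inl huv
      · have := induce_pair_connected_of_adj huv
        rw [Finset.coe_insert, Finset.coe_singleton]
        exact this
      · intro y hy
        simp only [Finset.mem_union, mem_neighborFinset] at hy
        rcases hy with hy | hy
        · exact Or.inr ⟨u, by simp, hy⟩
        · exact Or.inr ⟨v, by simp, hy⟩
    have h1 := hL _ _ hg
    have hdisj : Disjoint (G.neighborFinset u) (G.neighborFinset v) := by
      rw [Finset.disjoint_left]
      intro z hz hz'
      rw [mem_neighborFinset] at hz hz'
      exact hfree {u, v, z} (is3Clique_triple_iff.2 ⟨huv, hz, hz'⟩)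
    rw [Finset.card_union_of_disjoint hdisj, Finset.card_pair huv.ne,
      card_neighborFinset_eq_degree, card_neighborFinset_eq_degree] at h1
    push_cast at h1
    linarith
  have h1 := hnn u
  have h2 := hnn v
  simp only [Finset.sum_sub_distrib] at hsum
  zify at h1 h2
  linarith

open Classical in
lemma core_bound {V : Type*} [Fintype V] (G : SimpleGraph V) (hfree : G.CliqueFree 3)
    (hn : 3 < Fintype.card V) (L : ℤ)
    (hL : ∀ K S : Finset V, GoodPair G K S → (S.card : ℤ) ≤ L + K.card) :
    ∀ (N : ℕ) (F : Finset (Finset V × Finset V)), F.card = N →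
    (∀ p ∈ F, GoodPair G p.1 p.2 ∧ 2 ≤ p.2.card) →
    (∀ u v, u ≠ v → ¬ G.Adj u v → ∃ p ∈ F, u ∈ p.2 ∧ v ∈ p.2) →
    2 * (Fintype.card V : ℤ) - 2 - L ≤ ∑ p ∈ F, pcost p := by
  intro N
  induction N using Nat.strong_induction_on with
  | _ N ih =>
  intro F hN hF hcov
  have hkpos : ∀ p ∈ F, (1 : ℤ) ≤ p.1.card := by
    intro p hp
    exact_mod_cast Finset.card_pos.2 (hF p hp).1.nonempty
  have hcost0 : ∀ p ∈ F, (p.1.card : ℤ) ≤ pcost p := by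
    intro p hp
    have := (hF p hp).2
    unfold pcost
    zify at this
    linarith
  by_cases hm : ∃ p ∈ F, ∃ q ∈ F, p ≠ q ∧ ∃ x, x ∈ p.2 ∧ x ∈ q.2 ∧
      pcost (insert x (p.1 ∪ q.1), p.2 ∪ q.2) ≤ pcost p + pcost q
  · obtain ⟨p, hp, q, hq, hpq, x, hxp, hxq, hc⟩ := hm
    set r := (insert x (p.1 ∪ q.1), p.2 ∪ q.2) with hr
    have hqe : q ∈ F.erase p := Finset.mem_erase.2 ⟨hpq.symm, hq⟩
    have e1 := Finset.add_sum_erase F pcost hp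
    have e2 := Finset.add_sum_erase (F.erase p) pcost hqe
    have c1 := Finset.card_erase_add_one hp
    have c2 := Finset.card_erase_add_one hqe
    have c3 := Finset.card_insert_le r ((F.erase p).erase q)
    have hgood : GoodPair G r.1 r.2 := (hF p hp).1.merge (hF q hq).1 hxp hxq
    have hr2 : 2 ≤ r.2.card := (hF p hp).2.trans (Finset.card_le_card Finset.subset_union_left)
    have hr0 : 0 ≤ pcost r := by
      unfold pcost
      zify at hr2
      have : (0 : ℤ) ≤ r.1.card := by positivity
      linarith
    have := ih (insert r ((F.erase p).erase q)).card (by omega) _ rfl (by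
      intro s hs
      rcases Finset.mem_insert.1 hs with rfl | hs
      · exact ⟨hgood, hr2⟩
      · exact hF s (Finset.mem_of_mem_erase (Finset.mem_of_mem_erase hs))) (by
      intro u v huv hadj
      obtain ⟨s, hs, hu, hv⟩ := hcov u v huv hadj
      by_cases h1 : s = p
      · subst h1
        exact ⟨r, Finset.mem_insert_self _ _, Finset.mem_union_left _ hu,
          Finset.mem_union_left _ hv⟩
      by_cases h2 : s = q
      · subst h2
        exact ⟨r, Finset.mem_insert_self _ _, Finset.mem_union_right _ hu,
          Finset.mem_union_right _ hv⟩
      exact ⟨s, Finset.mem_insert_of_mem (Finset.mem_erase.2 ⟨h2, Finset.mem_erase.2 ⟨h1, hs⟩⟩),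
        hu, hv⟩)
    have h4 : ∑ p ∈ insert r ((F.erase p).erase q), pcost p
        ≤ pcost r + ∑ p ∈ (F.erase p).erase q, pcost p := by
      by_cases hrm : r ∈ (F.erase p).erase q
      · rw [Finset.insert_eq_of_mem hrm]; linarith
      · rw [Finset.sum_insert hrm]
    linarith
  push Not at hm
  -- intersections have at most two elements
  have hcostm : ∀ (p q : Finset V × Finset V) (x : V),
      pcost (insert x (p.1 ∪ q.1), p.2 ∪ q.2) ≤
        p.1.card + q.1.card + 1 + p.2.card + q.2.card - (p.2 ∩ q.2).card - 2 := by
    intro p q x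
    have h1 := Finset.card_insert_le x (p.1 ∪ q.1)
    have h2 := Finset.card_union_le p.1 q.1
    have h3 := Finset.card_union_add_card_inter p.2 q.2
    unfold pcost
    simp only
    omega
  have hint : ∀ p ∈ F, ∀ q ∈ F, p ≠ q → (p.2 ∩ q.2).card ≤ 2 := by
    intro p hp q hq hpq
    by_contra hc
    push Not at hc
    obtain ⟨x, hx⟩ : (p.2 ∩ q.2).Nonempty := Finset.card_pos.1 (by omega)
    rw [Finset.mem_inter] at hx
    have h1 := hm p hp q hq hpq x hx.1 hx.2
    have h2 := hcostm p q x
    unfold pcost at h1 h2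
    omega
  have huniq : ∀ p ∈ F, ∀ u ∈ p.1, ∀ v ∈ p.2, u ≠ v → ∀ q ∈ F, q ≠ p → ¬ (u ∈ q.2 ∧ v ∈ q.2) := by
    rintro p hp u hu v hv huv q hq hqp ⟨hu', hv'⟩
    have hup := (hF p hp).1.sub hu
    have h1 := hm p hp q hq hqp.symm u hup hu'
    have h2 : insert u (p.1 ∪ q.1) = p.1 ∪ q.1 :=
      Finset.insert_eq_of_mem (Finset.mem_union_left _ hu)
    rw [h2] at h1
    have h3 : 2 ≤ (p.2 ∩ q.2).card := by
      rw [← Finset.card_pair huv]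
      apply Finset.card_le_card
      intro z hz
      simp only [Finset.mem_insert, Finset.mem_singleton] at hz
      rw [Finset.mem_inter]
      rcases hz with rfl | rfl
      · exact ⟨hup, hu'⟩
      · exact ⟨hv, hv'⟩
    have h4 := Finset.card_union_le p.1 q.1
    have h5 := Finset.card_union_add_card_inter p.2 q.2
    unfold pcost at h1
    simp only at h1
    omega
  by_cases huniv : ∃ p ∈ F, p.2 = Finset.univ
  · obtain ⟨p, hp, hpu⟩ := huniv
    have h1 := hL p.1 p.2 (hF p hp).1
    have h2 : pcost p ≤ ∑ p ∈ F, pcost p :=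
      Finset.single_le_sum (f := pcost) (fun q hq => by
        have := hkpos q hq
        have := hcost0 q hq
        linarith) hp
    unfold pcost at h2 ⊢
    rw [hpu, Finset.card_univ] at h1 h2
    linarith
  push Not at huniv
  have hout : ∀ p ∈ F, ∃ w, w ∉ p.2 := by
    intro p hp
    by_contra hc
    push Not at hc
    exact huniv p hp (Finset.eq_univ_of_forall hc)
  -- another member
  have hother : ∀ p ∈ F, ∃ q ∈ F, q ≠ p := by
    intro p hp
    by_contra hc
    push Not at hc
    obtain ⟨w, hw⟩ := hout p hp
    obtain ⟨x, hx⟩ := (hF p hp).1.nonempty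
    have hx := (hF p hp).1.sub hx
    obtain ⟨y, hy, hxy⟩ := (hF p hp).1.exists_nbr (hF p hp).2 hx
    have hadj : ∀ z ∈ p.2, G.Adj w z := by
      intro z hz
      by_contra hwz
      obtain ⟨q, hq, hq1, -⟩ := hcov w z (by rintro rfl; exact hw hz) hwz
      rw [hc q hq] at hq1
      exact hw hq1
    exact hfree {w, x, y} (is3Clique_triple_iff.2 ⟨hadj x hx, hadj y hy, hxy⟩)
  have hne : F.Nonempty := by
    obtain ⟨a, b, c, hab, hac, hbc⟩ := Fintype.two_lt_card_iff.1 (by omega : 2 < Fintype.card V)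
    by_contra hc
    have hadj : ∀ u v, u ≠ v → G.Adj u v := by
      intro u v huv
      by_contra hx
      obtain ⟨p, hp, -⟩ := hcov u v huv hx
      exact hc ⟨p, hp⟩
    exact hfree {a, b, c} (is3Clique_triple_iff.2 ⟨hadj _ _ hab, hadj _ _ hac, hadj _ _ hbc⟩)
  -- contribution of sets not containing both ends
  have hcontr : ∀ p ∈ F, ∀ u v, ¬ (u ∈ p.2 ∧ v ∈ p.2) →
      (p.1.card : ℤ) ≤ pcost p - pcov G u p - pcov G v p := by
    intro p hp u v huv
    have h1 := pcov_le G u p (hF p hp).1 (hF p hp).2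
    have h2 := pcov_le G v p (hF p hp).1 (hF p hp).2
    have h3 : pcov G u p = 0 ∨ pcov G v p = 0 := by
      by_cases hu : u ∈ p.2
      · right; unfold pcov; rw [if_neg (fun hv => huv ⟨hu, hv⟩)]
      · left; unfold pcov; rw [if_neg hu]
    unfold pcost
    omega
  by_cases hedge : ∃ u v, G.Adj u v ∧ ∀ p ∈ F, ¬ (u ∈ p.2 ∧ v ∈ p.2)
  · obtain ⟨u, v, huv, hno⟩ := hedge
    apply edge_finish G hfree L hL F hcov u v huv
    obtain ⟨p, hp⟩ := hne
    obtain ⟨q, hq, hqp⟩ := hother p hp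
    have hle : ∑ p ∈ F, (1 : ℤ) ≤ ∑ p ∈ F, (pcost p - pcov G u p - pcov G v p) :=
      Finset.sum_le_sum fun r hr => (hkpos r hr).trans (hcontr r hr u v (hno r hr))
    have : 1 < F.card := Finset.one_lt_card.2 ⟨p, hp, q, hq, hqp.symm⟩
    rw [Finset.sum_const, nsmul_eq_mul, mul_one] at hle
    zify at this
    linarith
  push Not at hedge
  have hall : ∀ u v, u ≠ v → ∃ p ∈ F, u ∈ p.2 ∧ v ∈ p.2 := by
    intro u v huv
    by_cases h : G.Adj u v
    · exact hedge u v h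
    · exact hcov u v huv h
  by_cases hone : ∃ p ∈ F, p.1.card = 1
  · obtain ⟨p, hp, hp1⟩ := hone
    obtain ⟨u, hu⟩ := Finset.card_eq_one.1 hp1
    have huK : u ∈ p.1 := by rw [hu]; simp
    have huS := (hF p hp).1.sub huK
    obtain ⟨v, hv, huv⟩ := (hF p hp).1.exists_nbr (hF p hp).2 huS
    apply edge_finish G hfree L hL F hcov u v huv
    obtain ⟨q, hq, hqp⟩ := hother p hp
    rw [← Finset.add_sum_erase F _ hp]
    have h1 : pcov G u p = 0 := by
      unfold pcov
      rw [if_pos huS, Finset.card_eq_zero, Finset.filter_eq_empty_iff]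
      rintro y hy ⟨hy1, hy2⟩
      rcases (hF p hp).1.dom y hy with h | ⟨x, hx, hxy⟩
      · rw [hu, Finset.mem_singleton] at h
        exact hy1 h
      · rw [hu, Finset.mem_singleton] at hx
        subst hx
        exact hy2 hxy
    have h2 := pcov_le G v p (hF p hp).1 (hF p hp).2
    have h3 : ∑ p ∈ F.erase p, (1 : ℤ) ≤ ∑ p ∈ F.erase p, (pcost p - pcov G u p - pcov G v p) :=
      Finset.sum_le_sum fun r hr => by
        rw [Finset.mem_erase] at hr
        exact (hkpos r hr.2).trans (hcontr r hr.2 u v (huniq p hp u huK v hv huv.ne r hr.2 hr.1))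
    have h4 : 0 < (F.erase p).card := Finset.card_pos.2 ⟨q, Finset.mem_erase.2 ⟨hqp, hq⟩⟩
    rw [Finset.sum_const, nsmul_eq_mul, mul_one] at h3
    have h5 : 1 ≤ pcost p - pcov G u p - pcov G v p := by
      unfold pcost
      rw [h1]
      omega
    zify at h4
    linarith
  push Not at hone
  obtain ⟨p, hp⟩ := hne
  obtain ⟨u, huK⟩ := (hF p hp).1.nonempty
  have huS := (hF p hp).1.sub huK
  obtain ⟨v, hv, huv⟩ := (hF p hp).1.exists_nbr (hF p hp).2 huS
  apply edge_finish G hfree L hL F hcov u v huv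
  rw [← Finset.add_sum_erase F _ hp]
  obtain ⟨w, hw⟩ := hout p hp
  have h1 : p.2.card ≤ ∑ q ∈ F.erase p, (p.2 ∩ (if w ∈ q.2 then q.2 else ∅)).card := by
    refine (Finset.card_le_card ?_).trans Finset.card_biUnion_le
    intro z hz
    obtain ⟨q, hq, hwq, hzq⟩ := hall w z (by rintro rfl; exact hw hz)
    simp only [Finset.mem_biUnion]
    refine ⟨q, Finset.mem_erase.2 ⟨?_, hq⟩, ?_⟩
    · rintro rfl; exact hw hwq
    · rw [if_pos hwq]; exact Finset.mem_inter.2 ⟨hz, hzq⟩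
  have h2 : ((∑ q ∈ F.erase p, (p.2 ∩ (if w ∈ q.2 then q.2 else ∅)).card : ℕ) : ℤ)
      ≤ ∑ q ∈ F.erase p, (pcost q - pcov G u q - pcov G v q) := by
    push_cast
    refine Finset.sum_le_sum fun r hr => ?_
    rw [Finset.mem_erase] at hr
    have a1 := hcontr r hr.2 u v (huniq p hp u huK v hv huv.ne r hr.2 hr.1)
    have a2 := hkpos r hr.2
    have a3 := hone r hr.2
    have a4 : (p.2 ∩ (if w ∈ r.2 then r.2 else ∅)).card ≤ 2 := by
      split_ifs
      · exact hint p hp r hr.2 hr.1.symm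
      · simp
    omega
  have h3 := pcov_le G u p (hF p hp).1 (hF p hp).2
  have h4 := pcov_le G v p (hF p hp).1 (hF p hp).2
  have h5 := hkpos p hp
  unfold pcost at h2 ⊢
  omega

lemma mem_internal_iff {V : Type*} {G : SimpleGraph V} {u v : V} (w : G.Walk u v) (x : V) :
    x ∈ w.support.tail.dropLast ↔ ∃ i, 0 < i ∧ i < w.length ∧ w.getVert i = x := by
  have hl := w.length_support
  rw [List.mem_iff_getElem]
  constructor
  · rintro ⟨i, hi, rfl⟩
    have hi' : i + 1 < w.length := by
      simp only [List.length_dropLast, List.length_tail] at hi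
      omega
    refine ⟨i + 1, by omega, hi', ?_⟩
    rw [List.getElem_dropLast, List.getElem_tail, Walk.support_getElem_eq_getVert]
  · rintro ⟨i, hi0, hi, rfl⟩
    refine ⟨i - 1, ?_, ?_⟩
    · simp only [List.length_dropLast, List.length_tail]
      omega
    · rw [List.getElem_dropLast, List.getElem_tail, Walk.support_getElem_eq_getVert]
      congr 1
      omega

lemma edge_mem_of_getVert {V : Type*} {G : SimpleGraph V} {u v : V} (w : G.Walk u v) {i : ℕ}
    (hi : i < w.length) : s(w.getVert i, w.getVert (i + 1)) ∈ w.edges := by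
  have h : i < w.darts.length := by rwa [Walk.length_darts]
  have h2 := List.getElem_mem h
  have h3 := List.mem_map_of_mem (f := Dart.edge) h2
  rw [Walk.darts_getElem_eq_getVert] at h3
  exact h3

open Classical in
lemma card_le_edges {V : Type*} [Fintype V] (A : SimpleGraph V) (r : V) (S : Finset V)
    (h : ∀ x ∈ S, A.Reachable r x) : S.card ≤ A.edgeSet.ncard + 1 := by
  set C := A.connectedComponentMk r
  have h1 := C.connected_toSimpleGraph.card_vert_le_card_edgeSet_add_one
  have h2 : S.card ≤ Nat.card C := by
    have : (S : Set V) ⊆ C.supp := by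
      intro x hx
      exact ConnectedComponent.eq.2 (h x hx).symm
    have h3 := Set.ncard_le_ncard this (Set.toFinite _)
    rw [Set.ncard_coe_finset] at h3
    exact h3
  have h3 : Nat.card C.toSimpleGraph.edgeSet ≤ A.edgeSet.ncard := by
    rw [← Nat.card_coe_set_eq]
    refine Nat.card_le_card_of_injective
      (fun e => (⟨Sym2.map Subtype.val e.1, ?_⟩ : A.edgeSet)) ?_
    · obtain ⟨e, he⟩ := e
      induction e with
      | _ a b => exact he
    · intro e e' hee
      have := congrArg Subtype.val hee
      exact Subtype.ext (Sym2.map.injective Subtype.val_injective this)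
  omega

open Classical in
lemma upper_bound {V : Type*} [Fintype V] (G : SimpleGraph V) (hG : G.Connected)
    (hn : 3 < Fintype.card V) (hfree : G.CliqueFree 3) (ce : Sym2 V → ℕ) (cv : V → ℕ)
    (hc : IsTMCColoring G ce cv) :
    (colorsUsed G ce cv : ℤ) ≤
      (G.edgeSet.ncard : ℤ) - (Fintype.card V : ℤ) + 2 + (maxLeaves G : ℤ) := by
  let H : SimpleGraph V :=
    { Adj := fun x y => G.Adj x y ∧ ce s(x, y) = cv x ∧ cv x = cv y
      symm := ⟨by
        rintro x y ⟨h1, h2, h3⟩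
        exact ⟨h1.symm, by rw [Sym2.eq_swap, h2, h3], h3.symm⟩⟩
      loopless := ⟨by
        rintro x ⟨h1, -⟩
        exact G.loopless.irrefl x h1⟩ }
  have hHG : H ≤ G := fun x y h => h.1
  let K : H.ConnectedComponent → Finset V := fun κ =>
    Finset.univ.filter (fun x => H.connectedComponentMk x = κ)
  have hK : ∀ κ x, x ∈ K κ ↔ H.connectedComponentMk x = κ := by
    intro κ x; simp [K]
  let S : H.ConnectedComponent → Finset V := fun κ =>
    K κ ∪ Finset.univ.filter (fun y => ∃ x ∈ K κ, G.Adj x y ∧ ce s(x, y) = cv x)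
  let E : H.ConnectedComponent → Finset (Sym2 V) := fun κ =>
    G.edgeFinset.filter (fun e => ∃ x ∈ K κ, x ∈ e ∧ ce e = cv x)
  have hS : ∀ κ y, y ∈ S κ ↔ y ∈ K κ ∨ ∃ x ∈ K κ, G.Adj x y ∧ ce s(x, y) = cv x := by
    intro κ y; simp [S]
  have hE : ∀ κ e, e ∈ E κ ↔ e ∈ G.edgeSet ∧ ∃ x ∈ K κ, x ∈ e ∧ ce e = cv x := by
    intro κ e; simp [E]
  have hreach : ∀ x y, H.Reachable x y → cv x = cv y := by
    intro x y h
    rw [reachable_iff_reflTransGen] at h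
    induction h with
    | refl => rfl
    | tail _ h2 ih => exact ih.trans h2.2.2
  have hKne : ∀ κ, (K κ).Nonempty := by
    intro κ
    obtain ⟨x, hx⟩ := κ.exists_rep
    exact ⟨x, (hK _ _).2 hx⟩
  have hKconst : ∀ κ, ∀ x ∈ K κ, ∀ y ∈ K κ, H.Reachable x y := by
    intro κ x hx y hy
    rw [hK] at hx hy
    exact ConnectedComponent.eq.1 (hx.trans hy.symm)
  have hgood : ∀ κ, GoodPair G (K κ) (S κ) := by
    intro κ
    refine ⟨fun x hx => (hS _ _).2 (Or.inl hx), ?_, ?_⟩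
    · have h1 := κ.connected_toSimpleGraph
      have h2 : (K κ : Set V) = κ.supp := by
        ext x
        simp [K]
      rw [h2]
      exact Connected.mono (fun a b hab => hHG hab) h1
    · intro y hy
      rcases (hS _ _).1 hy with h | ⟨x, hx, hxy, -⟩
      · exact Or.inl h
      · exact Or.inr ⟨x, hx, hxy⟩
  have hdisj : ∀ κ κ', κ ≠ κ' → Disjoint (E κ) (E κ') := by
    intro κ κ' hne
    rw [Finset.disjoint_left]
    intro e he he'
    rw [hE] at he he'
    obtain ⟨heG, x, hx, hxe, hxc⟩ := he
    obtain ⟨-, y, hy, hye, hyc⟩ := he'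
    rw [hK] at hx hy
    by_cases hxy : x = y
    · subst hxy; exact hne (hx.symm.trans hy)
    · have := (Sym2.mem_and_mem_iff hxy).1 ⟨hxe, hye⟩
      subst this
      have hadj : H.Adj x y := ⟨heG, hxc, hxc.symm.trans hyc⟩
      exact hne (hx.symm.trans ((ConnectedComponent.eq.2 hadj.reachable).trans hy))
  have hcardE : ∀ κ, (S κ).card ≤ (E κ).card + 1 := by
    intro κ
    obtain ⟨r, hr⟩ := hKne κ
    let A : SimpleGraph V := fromEdgeSet (E κ : Set (Sym2 V))
    have hA : ∀ x ∈ K κ, ∀ y, G.Adj x y → ce s(x, y) = cv x → A.Adj x y := by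
      intro x hx y hxy hcc
      rw [fromEdgeSet_adj]
      refine ⟨?_, hxy.ne⟩
      rw [Finset.mem_coe, hE]
      exact ⟨hxy, x, hx, by simp, hcc⟩
    have hAK : ∀ x, H.Reachable r x → A.Reachable r x := by
      intro x h
      rw [reachable_iff_reflTransGen] at h
      induction h with
      | refl => exact Reachable.refl _
      | @tail b c h1 h2 ih =>
        rw [← reachable_iff_reflTransGen] at h1
        have hb : b ∈ K κ := by
          rw [hK] at hr ⊢
          rw [← hr]
          exact ConnectedComponent.eq.2 h1.symm
        exact ih.trans (hA b hb c h2.1 h2.2.1).reachable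
    have h1 := card_le_edges A r (S κ) (by
      intro y hy
      rcases (hS _ _).1 hy with h | ⟨x, hx, hxy, hcc⟩
      · exact hAK y (hKconst κ r hr y h)
      · exact (hAK x (hKconst κ r hr x hx)).trans (hA x hx y hxy hcc).reachable)
    have h2 : A.edgeSet.ncard ≤ (E κ).card := by
      rw [← Set.ncard_coe_finset]
      refine Set.ncard_le_ncard ?_ (Set.toFinite _)
      rw [edgeSet_fromEdgeSet]
      exact Set.sdiff_subset
    omega
  -- counting colors
  let R := G.edgeFinset \ Finset.univ.biUnion E
  have hcolors : colorsUsed G ce cv ≤ Fintype.card H.ConnectedComponent + R.card := by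
    unfold colorsUsed
    have hsub : ce '' G.edgeSet ∪ Set.range cv ⊆
        ((Finset.univ.image (fun κ : H.ConnectedComponent => cv κ.out) ∪ R.image ce : Finset ℕ) :
          Set ℕ) := by
      have hout : ∀ κ, ∀ x ∈ K κ, cv κ.out = cv x := by
        intro κ x hx
        apply hreach
        refine hKconst κ _ ?_ x hx
        rw [hK]
        exact Quot.out_eq κ
      rintro c (⟨e, he, rfl⟩ | ⟨x, rfl⟩)
      · by_cases hex : ∃ κ, e ∈ E κ
        · obtain ⟨κ, hκ⟩ := hex
          obtain ⟨-, x, hx, -, hxc⟩ := (hE _ _).1 hκ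
          rw [Finset.coe_union]
          left
          rw [Finset.mem_coe, Finset.mem_image]
          exact ⟨κ, Finset.mem_univ _, by rw [hxc, hout κ x hx]⟩
        · rw [Finset.coe_union]
          right
          rw [Finset.mem_coe, Finset.mem_image]
          refine ⟨e, ?_, rfl⟩
          rw [Finset.mem_sdiff, mem_edgeFinset]
          refine ⟨he, ?_⟩
          rw [Finset.mem_biUnion]
          rintro ⟨κ, -, hκ⟩
          exact hex ⟨κ, hκ⟩
      · rw [Finset.coe_union]
        left
        rw [Finset.mem_coe, Finset.mem_image]
        exact ⟨H.connectedComponentMk x, Finset.mem_univ _, hout _ x ((hK _ _).2 rfl)⟩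
    have h1 := Set.ncard_le_ncard hsub (Finset.finite_toSet _)
    rw [Set.ncard_coe_finset] at h1
    have h2 := Finset.card_union_le
      (Finset.univ.image (fun κ : H.ConnectedComponent => cv κ.out)) (R.image ce)
    have h3 := Finset.card_image_le (s := R) (f := ce)
    have h4 := Finset.card_image_le (s := (Finset.univ : Finset H.ConnectedComponent))
      (f := (fun κ : H.ConnectedComponent => cv κ.out))
    rw [Finset.card_univ] at h4
    omega
  have hm : R.card + ∑ κ, (E κ).card = G.edgeSet.ncard := by
    rw [← Finset.card_biUnion (fun κ _ κ' _ h => hdisj κ κ' h), ← coe_edgeFinset,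
      Set.ncard_coe_finset]
    apply Finset.card_sdiff_add_card_eq_card
    intro e he
    obtain ⟨κ, -, hκ⟩ := Finset.mem_biUnion.1 he
    exact mem_edgeFinset.2 ((hE _ _).1 hκ).1
  have hKn : ∑ κ, (K κ).card = Fintype.card V := by
    rw [← Finset.card_univ]
    exact (Finset.card_eq_sum_card_fiberwise (f := H.connectedComponentMk)
      (fun x _ => Finset.mem_coe.2 (Finset.mem_univ _))).symm
  have hsum1 : ∑ κ, ((S κ).card : ℤ) ≤ ∑ κ, (((E κ).card : ℤ) + 1) :=
    Finset.sum_le_sum fun κ _ => by exact_mod_cast hcardE κ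
  -- the family
  let F : Finset (Finset V × Finset V) :=
    (Finset.univ.filter (fun κ => 2 ≤ (S κ).card)).image (fun κ => (K κ, S κ))
  have hF : ∑ p ∈ F, pcost p ≤ ∑ κ, (((K κ).card : ℤ) + (S κ).card - 2) := by
    rw [Finset.sum_image]
    · refine Finset.sum_le_sum_of_subset_of_nonneg (Finset.subset_univ _) ?_
      intro κ _ _
      have h1 := Finset.card_pos.2 (hKne κ)
      have h2 := Finset.card_le_card (hgood κ).sub
      unfold pcost
      simp only
      omega
    · intro κ _ κ' _ h
      have h1 : K κ = K κ' := congrArg Prod.fst h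
      obtain ⟨x, hx⟩ := hKne κ
      have hx' := hx
      rw [h1] at hx'
      rw [hK] at hx hx'
      exact hx.symm.trans hx'
  have hcore := core_bound G hfree hn (maxLeaves G)
    (fun K S h => by exact_mod_cast leaves_of_good G hG hn _ K S rfl h) F.card F rfl
    (by
      intro p hp
      obtain ⟨κ, hκ, rfl⟩ := Finset.mem_image.1 hp
      exact ⟨hgood κ, (Finset.mem_filter.1 hκ).2⟩)
    (by
      intro u v huv hadj
      obtain ⟨w, -, c, hwe, hwv⟩ := hc u v huv
      have hlen : 2 ≤ w.length := by
        by_contra hlt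
        have h0 : w.length ≠ 0 := fun h => huv (Walk.eq_of_length_eq_zero h)
        have h1 : w.length = 1 := by omega
        exact hadj (Walk.adj_of_length_eq_one h1)
      have hwv' : ∀ i, 0 < i → i < w.length → cv (w.getVert i) = c := fun i h0 hi =>
        hwv _ ((mem_internal_iff w _).2 ⟨i, h0, hi, rfl⟩)
      have hwe' : ∀ i, i < w.length → ce s(w.getVert i, w.getVert (i + 1)) = c := fun i hi =>
        hwe _ (edge_mem_of_getVert w hi)
      let κ := H.connectedComponentMk (w.getVert 1)
      have hin : ∀ i, i + 1 < w.length → w.getVert (i + 1) ∈ K κ := by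
        intro i
        induction i with
        | zero => intro _; exact (hK _ _).2 rfl
        | succ i ih =>
          intro hi
          have h1 := ih (by omega)
          rw [hK] at h1 ⊢
          rw [← h1]
          refine ConnectedComponent.eq.2 (Reachable.symm (Adj.reachable ?_))
          refine ⟨w.adj_getVert_succ (by omega), ?_, ?_⟩
          · rw [hwe' _ (by omega), hwv' _ (by omega) (by omega)]
          · rw [hwv' _ (by omega) (by omega), hwv' _ (by omega) (by omega)]
      have hu : u ∈ S κ := by
        rw [hS]
        refine Or.inr ⟨w.getVert 1, hin 0 (by omega), ?_, ?_⟩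
        · have := w.adj_getVert_succ (i := 0) (by omega)
          rw [Walk.getVert_zero] at this
          exact this.symm
        · have := hwe' 0 (by omega)
          rw [Walk.getVert_zero] at this
          rw [Sym2.eq_swap, hwv' 1 (by omega) (by omega)]
          exact this
      have hv : v ∈ S κ := by
        rw [hS]
        obtain ⟨j, hj⟩ : ∃ j, w.length = j + 2 := ⟨w.length - 2, by omega⟩
        have hlast : w.getVert (j + 1 + 1) = v := by
          have := w.getVert_length
          rwa [hj] at this
        refine Or.inr ⟨w.getVert (j + 1), hin j (by omega), ?_, ?_⟩
        · have := w.adj_getVert_succ (i := j + 1) (by omega)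
          rwa [hlast] at this
        · have := hwe' (j + 1) (by omega)
          rw [hlast] at this
          rw [this, hwv' _ (by omega) (by omega)]
      refine ⟨(K κ, S κ), Finset.mem_image.2 ⟨κ, ?_, rfl⟩, hu, hv⟩
      rw [Finset.mem_filter]
      exact ⟨Finset.mem_univ _, Finset.one_lt_card.2 ⟨u, hu, v, hv, huv⟩⟩)
  have h2 : ∑ κ : H.ConnectedComponent, (((K κ).card : ℤ) + (S κ).card - 2)
      = ∑ κ, ((K κ).card : ℤ) + ∑ κ, ((S κ).card : ℤ) - 2 * Fintype.card H.ConnectedComponent := by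
    rw [Finset.sum_sub_distrib, Finset.sum_add_distrib, Finset.sum_const, Finset.card_univ]
    simp [mul_comm]
  have h3 : ∑ κ : H.ConnectedComponent, (((E κ).card : ℤ) + 1)
      = ∑ κ, ((E κ).card : ℤ) + Fintype.card H.ConnectedComponent := by
    rw [Finset.sum_add_distrib, Finset.sum_const, Finset.card_univ]
    simp
  zify at hm hKn hcolors
  linarith

open Classical in
lemma lower_bound {V : Type*} [Fintype V] (G : SimpleGraph V)
    (hn : 3 < Fintype.card V) (T : SimpleGraph V) (hTG : T ≤ G) (hT : T.IsTree) :
    ∃ ce cv, IsTMCColoring G ce cv ∧ (colorsUsed G ce cv : ℤ) =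
      (G.edgeSet.ncard : ℤ) - (Fintype.card V : ℤ) + 2 + (numLeaves T : ℤ) := by
  obtain ⟨φ⟩ : Nonempty (Sym2 V ⊕ V ≃ Fin (Fintype.card (Sym2 V ⊕ V))) := ⟨Fintype.equivFin _⟩
  let g : Sym2 V ⊕ V → ℕ := fun a => (φ a : ℕ) + 1
  have hg : Function.Injective g := by
    intro a b hab
    apply φ.injective
    apply Fin.ext
    simpa [g] using hab
  let ce : Sym2 V → ℕ := fun e => if e ∈ T.edgeSet then 0 else g (Sum.inl e)
  let cv : V → ℕ := fun v => if (T.neighborSet v).ncard = 1 then g (Sum.inr v) else 0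
  refine ⟨ce, cv, ?_, ?_⟩
  · intro u v huv
    obtain ⟨p, hp, -⟩ := hT.existsUnique_path u v
    refine ⟨p.mapLe hTG, (Walk.isPath_mapLe hTG).2 hp, 0, ?_, ?_⟩
    · intro e he
      rw [Walk.edges_mapLe_eq_edges] at he
      exact if_pos (p.edges_subset_edgeSet he)
    · intro x hx
      rw [Walk.support_mapLe_eq_support, mem_internal_iff] at hx
      obtain ⟨i, hi0, hi, rfl⟩ := hx
      apply if_neg
      intro h1
      obtain ⟨a, ha⟩ := Set.ncard_eq_one.1 h1
      have hnext : p.getVert (i + 1) ∈ T.neighborSet (p.getVert i) := p.adj_getVert_succ hi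
      have hprev : p.getVert (i - 1) ∈ T.neighborSet (p.getVert i) := by
        have := p.adj_getVert_succ (i := i - 1) (by omega)
        rw [Nat.sub_add_cancel hi0] at this
        exact this.symm
      rw [ha, Set.mem_singleton_iff] at hnext hprev
      have := hp.getVert_injOn (by show i + 1 ≤ _; omega) (by show i - 1 ≤ _; omega)
        (hnext.trans hprev.symm)
      omega
  · have hTm : T.edgeSet.ncard + 1 = Fintype.card V := by
      rw [← hT.card_edgeFinset, ← coe_edgeFinset, Set.ncard_coe_finset]
    let A : Set (Sym2 V ⊕ V) := Sum.inl '' (G.edgeSet \ T.edgeSet) ∪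
      Sum.inr '' {v : V | (T.neighborSet v).ncard = 1}
    have hset : ce '' G.edgeSet ∪ Set.range cv = insert 0 (g '' A) := by
      ext c
      constructor
      · rintro (⟨e, he, rfl⟩ | ⟨x, rfl⟩)
        · by_cases h : e ∈ T.edgeSet
          · left; exact if_pos h
          · right
            exact ⟨Sum.inl e, Or.inl ⟨e, ⟨he, h⟩, rfl⟩, (if_neg h).symm⟩
        · by_cases h : (T.neighborSet x).ncard = 1
          · right
            exact ⟨Sum.inr x, Or.inr ⟨x, h, rfl⟩, (if_pos h).symm⟩
          · left; exact if_neg h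
      · rintro (rfl | ⟨a, (⟨e, ⟨he, h⟩, rfl⟩ | ⟨x, h, rfl⟩), rfl⟩)
        · left
          have hne : T.edgeSet.Nonempty := by
            rw [← Set.ncard_pos (Set.toFinite _)]
            omega
          obtain ⟨e, he⟩ := hne
          exact ⟨e, edgeSet_mono hTG he, if_pos he⟩
        · left
          exact ⟨e, he, if_neg h⟩
        · right
          exact ⟨x, if_pos h⟩
    unfold colorsUsed numLeaves
    rw [hset, Set.ncard_insert_of_notMem (by rintro ⟨a, -, ha⟩; simp [g] at ha) (Set.toFinite _),
      Set.ncard_image_of_injective _ hg, Set.ncard_union_eq _ (Set.toFinite _) (Set.toFinite _),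
      Set.ncard_image_of_injective _ Sum.inl_injective,
      Set.ncard_image_of_injective _ Sum.inr_injective]
    · have := Set.ncard_sdiff_add_ncard_of_subset (edgeSet_mono hTG) (Set.toFinite _)
      push_cast
      zify at this hTm
      linarith
    · rw [Set.disjoint_left]
      rintro _ ⟨a, -, rfl⟩ ⟨b, -, hb⟩
      cases hb

theorem stmt4 {V : Type*} [Fintype V] (G : SimpleGraph V) (hG : G.Connected)
    (hn : 3 < Fintype.card V) (hfree : G.CliqueFree 3) :
    (tmc G : ℤ) = (G.edgeSet.ncard : ℤ) - (Fintype.card V : ℤ) + 2 + (maxLeaves G : ℤ) := by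
  obtain ⟨T0, hT0, hT0'⟩ := hG.exists_isTree_le
  obtain ⟨T, hTG, hT, hTl⟩ := Nat.sSup_mem
    (s := {k | ∃ T : SimpleGraph V, T ≤ G ∧ T.IsTree ∧ numLeaves T = k})
    ⟨_, T0, hT0, hT0', rfl⟩ (leaves_bddAbove G)
  change numLeaves T = maxLeaves G at hTl
  obtain ⟨ce, cv, hc, hcard⟩ := lower_bound G hn T hTG hT
  rw [hTl] at hcard
  rw [← hcard]
  norm_cast
  apply le_antisymm
  · refine csSup_le ⟨_, ce, cv, hc, rfl⟩ ?_
    rintro k ⟨ce', cv', hc', rfl⟩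
    have := upper_bound G hG hn hfree ce' cv' hc'
    rw [← hcard] at this
    exact_mod_cast this
  · refine le_csSup ⟨colorsUsed G ce cv, ?_⟩ ⟨ce, cv, hc, rfl⟩
    rintro k ⟨ce', cv', hc', rfl⟩
    have := upper_bound G hG hn hfree ce' cv' hc'
    rw [← hcard] at this
    exact_mod_cast this
end

section
/- Let G be a connected graph of order n > 3 with m edges and maximum degree Δ(G). If Δ(G) < n − (2m − 3(n−1))/(n−3), then tmc(G) = m − n + 2 + l(G). -/
open SimpleGraph

/-- ordered pairs of distinct nonadjacent vertices inside `B` -/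
noncomputable def nonAdjPairs {V : Type*} (G : SimpleGraph V) (B : Finset V) : Finset (V × V) := by
  classical exact (B ×ˢ B).filter (fun p => p.1 ≠ p.2 ∧ ¬ G.Adj p.1 p.2)

/-- ordered pairs of adjacent vertices inside `B` -/
noncomputable def adjPairs {V : Type*} (G : SimpleGraph V) (B : Finset V) : Finset (V × V) := by
  classical exact (B ×ˢ B).filter (fun p => G.Adj p.1 p.2)

/-- edges inside `B` -/
noncomputable def edgesIn {V : Type*} [Fintype V] (G : SimpleGraph V) (B : Finset V) :
    Finset (Sym2 V) := by
  classical exact G.edgeFinset.filter (fun e => ∀ x ∈ e, x ∈ B)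

lemma mem_edgesIn {V : Type*} [Fintype V] {G : SimpleGraph V} {B : Finset V} {e : Sym2 V} :
    e ∈ edgesIn G B ↔ e ∈ G.edgeSet ∧ ∀ x ∈ e, x ∈ B := by
  classical simp [edgesIn]

lemma card_adj_add_nonAdj {V : Type*} (G : SimpleGraph V) (B : Finset V) :
    (adjPairs G B).card + (nonAdjPairs G B).card + B.card = B.card * B.card := by
  classical
  have h1 := Finset.card_filter_add_card_filter_not (s := B.offDiag) (fun p => G.Adj p.1 p.2)
  have h2 : adjPairs G B = B.offDiag.filter (fun p => G.Adj p.1 p.2) := by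
    ext p
    have : G.Adj p.1 p.2 → p.1 ≠ p.2 := fun h => h.ne
    simp only [adjPairs, Finset.mem_filter, Finset.mem_product, Finset.mem_offDiag]; tauto
  have h3 : nonAdjPairs G B = B.offDiag.filter (fun p => ¬ G.Adj p.1 p.2) := by
    ext p
    simp only [nonAdjPairs, Finset.mem_filter, Finset.mem_product, Finset.mem_offDiag]; tauto
  rw [h2, h3, h1, Finset.offDiag_card]
  exact Nat.sub_add_cancel (Nat.le_mul_self _)

lemma card_adjPairs {V : Type*} [Fintype V] (G : SimpleGraph V) (B : Finset V) :
    (adjPairs G B).card = 2 * (edgesIn G B).card := by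
  classical
  rw [Finset.card_eq_sum_card_fiberwise (f := fun p : V × V => s(p.1, p.2)) (t := edgesIn G B)]
  · rw [Finset.sum_const_nat (m := 2), mul_comm]
    intro e he
    rw [mem_edgesIn] at he
    obtain ⟨he, hB⟩ := he
    induction e with | _ a b =>
    have hab : G.Adj a b := he
    have ha : a ∈ B := hB a (by simp)
    have hb : b ∈ B := hB b (by simp)
    have : (adjPairs G B).filter (fun p => s(p.1, p.2) = s(a, b)) = {(a, b), (b, a)} := by
      ext ⟨x, y⟩
      simp only [adjPairs, Finset.mem_filter, Finset.mem_product, Sym2.eq_iff, Finset.mem_insert,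
        Finset.mem_singleton, Prod.mk.injEq]
      constructor
      · tauto
      · rintro (⟨rfl, rfl⟩ | ⟨rfl, rfl⟩)
        · tauto
        · have := hab.symm; tauto
    rw [this, Finset.card_pair]
    intro h
    exact hab.ne (Prod.mk.inj h).1
  · intro p hp
    simp only [adjPairs, Finset.coe_filter, Finset.mem_product, Set.mem_ofPred_eq] at hp
    simp only [Finset.mem_coe, mem_edgesIn, Sym2.mem_iff, SimpleGraph.mem_edgeSet]
    refine ⟨hp.2, ?_⟩
    rintro x (rfl | rfl)
    · exact hp.1.1
    · exact hp.1.2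

lemma card_le_edgesIn {V : Type*} [Fintype V] (G : SimpleGraph V) (B : Finset V)
    (hB : B.Nonempty) (h : (G.induce (B : Set V)).Preconnected) :
    B.card ≤ (edgesIn G B).card + 1 := by
  classical
  have hne : Nonempty (B : Set V) := hB.to_subtype
  have hc : (G.induce (B : Set V)).Connected := ⟨h⟩
  have h1 := hc.card_vert_le_card_edgeSet_add_one
  have h2 : Nat.card (G.induce (B : Set V)).edgeSet ≤ (edgesIn G B).card := by
    have hinj : Function.Injective (Sym2.map (Subtype.val : ↥(B : Set V) → V)) :=
      Sym2.map.injective (f := (Subtype.val : ↥(B : Set V) → V)) Subtype.val_injective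
    rw [Nat.card_coe_set_eq, ← Set.ncard_image_of_injective _ hinj, ← Set.ncard_coe_finset]
    apply Set.ncard_le_ncard _ (Finset.finite_toSet _)
    rintro e ⟨e', he', rfl⟩
    rw [Finset.mem_coe, mem_edgesIn]
    induction e' with | _ a b =>
    have hab : G.Adj a b := he'
    refine ⟨hab, ?_⟩
    intro x hx
    simp only [Sym2.map_mk, Sym2.mem_iff] at hx
    rcases hx with rfl | rfl
    · exact a.2
    · exact b.2
  have h3 : Nat.card (B : Set V) = B.card := by simp
  omega

/-- the family property -/
def FamOK {V : Type*} (G : SimpleGraph V) (F : Finset (Finset V)) : Prop :=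
  (∀ B ∈ F, 3 ≤ B.card ∧ (G.induce (B : Set V)).Preconnected) ∧
  ∀ u v, u ≠ v → ¬ G.Adj u v → ∃ B ∈ F, u ∈ B ∧ v ∈ B

lemma exists_linear {V : Type*} (G : SimpleGraph V) (k : ℕ) :
    ∀ F : Finset (Finset V), F.card ≤ k → FamOK G F →
    ∃ F', FamOK G F' ∧ (∀ S ∈ F', ∀ T ∈ F', S ≠ T → ∀ x ∈ S, x ∈ T → ∀ y ∈ S, y ∈ T → x = y) ∧
      ∑ B ∈ F', (B.card - 2) ≤ ∑ B ∈ F, (B.card - 2) := by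
  classical
  induction k with
  | zero =>
    intro F hF hok
    refine ⟨F, hok, ?_, le_rfl⟩
    have : F = ∅ := by simpa using hF
    simp [this]
  | succ k ih =>
    intro F hF hok
    by_cases hlin : ∀ S ∈ F, ∀ T ∈ F, S ≠ T → ∀ x ∈ S, x ∈ T → ∀ y ∈ S, y ∈ T → x = y
    · exact ⟨F, hok, hlin, le_rfl⟩
    push Not at hlin
    obtain ⟨S, hS, T, hT, hST, x, hxS, hxT, y, hyS, hyT, hxy⟩ := hlin
    have hTS : T ∈ F.erase S := Finset.mem_erase.2 ⟨hST.symm, hT⟩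
    set R := (F.erase S).erase T with hR
    have hRcard : R.card + 2 = F.card := by
      rw [hR, Finset.card_erase_of_mem hTS, Finset.card_erase_of_mem hS]
      have : 1 < F.card := Finset.one_lt_card.2 ⟨S, hS, T, hT, hST⟩
      omega
    have hsum : ∑ B ∈ F, (B.card - 2) = ∑ B ∈ R, (B.card - 2) + (T.card - 2) + (S.card - 2) := by
      rw [hR, Finset.sum_erase_add _ _ hTS, Finset.sum_erase_add _ _ hS]
    have hu : (S ∪ T).card + 2 ≤ S.card + T.card := by
      rw [← Finset.card_union_add_card_inter]
      have : 1 < (S ∩ T).card := Finset.one_lt_card.2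
        ⟨x, by simp [hxS, hxT], y, by simp [hyS, hyT], hxy⟩
      omega
    have hS3 := (hok.1 S hS).1
    have hT3 := (hok.1 T hT).1
    have hmono : S.card ≤ (S ∪ T).card := Finset.card_le_card Finset.subset_union_left
    obtain ⟨F', h1, h2, h3⟩ := ih (insert (S ∪ T) R)
      (by have := Finset.card_insert_le (S ∪ T) R; omega) (by
        constructor
        · intro B hB
          rcases Finset.mem_insert.1 hB with rfl | hB
          · refine ⟨by omega, ?_⟩
            have := SimpleGraph.induce_union_connected (hok.1 S hS).2 (hok.1 T hT).2
              ⟨x, hxS, hxT⟩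
            rw [Finset.coe_union]
            exact this.preconnected
          · exact hok.1 B (Finset.mem_of_mem_erase (Finset.mem_of_mem_erase hB))
        · intro u v huv hadj
          obtain ⟨B, hB, hBu, hBv⟩ := hok.2 u v huv hadj
          by_cases h : B = S
          · subst h; exact ⟨B ∪ T, by simp, by simp [hBu], by simp [hBv]⟩
          by_cases h' : B = T
          · subst h'; exact ⟨S ∪ B, by simp, by simp [hBu], by simp [hBv]⟩
          · exact ⟨B, by simp [hR, h, h', hB], hBu, hBv⟩)
    refine ⟨F', h1, h2, h3.trans ?_⟩
    have h4 : ∑ B ∈ insert (S ∪ T) R, (B.card - 2) ≤ ((S ∪ T).card - 2) + ∑ B ∈ R, (B.card - 2) := by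
      by_cases hm : S ∪ T ∈ R
      · rw [Finset.insert_eq_of_mem hm]; omega
      · rw [Finset.sum_insert hm]
    omega

lemma linear_bound {V : Type*} [Fintype V] (G : SimpleGraph V) (D : ℕ)
    (hD : ∀ v, ∀ S : Finset V, (∀ x ∈ S, G.Adj v x) → S.card ≤ D)
    (hn : 3 ≤ Fintype.card V)
    (hnum : (Fintype.card V - 3) * D < (nonAdjPairs G Finset.univ).card + (Fintype.card V - 3))
    (F : Finset (Finset V)) (hF : FamOK G F)
    (hlin : ∀ S ∈ F, ∀ T ∈ F, S ≠ T → ∀ x ∈ S, x ∈ T → ∀ y ∈ S, y ∈ T → x = y) :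
    Fintype.card V ≤ ∑ B ∈ F, (B.card - 2) + 2 := by
  classical
  by_contra hcon
  push Not at hcon
  have hsum : ∑ B ∈ F, (B.card - 2) ≤ Fintype.card V - 3 := by omega
  have hNB : ∀ B ∈ F, (nonAdjPairs G B).card ≤ (B.card - 1) * (B.card - 2) := by
    intro B hB
    obtain ⟨h3, hc⟩ := hF.1 B hB
    have h1 := card_adj_add_nonAdj G B
    have h2 := card_le_edgesIn G B (Finset.card_pos.1 (by omega)) hc
    rw [card_adjPairs] at h1
    obtain ⟨t, ht⟩ : ∃ t, B.card = t + 3 := ⟨B.card - 3, by omega⟩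
    rw [ht] at h1 h2 ⊢
    have e1 : t + 3 - 1 = t + 2 := by omega
    have e2 : t + 3 - 2 = t + 1 := by omega
    rw [e1, e2]
    nlinarith
  have hN : (nonAdjPairs G Finset.univ).card ≤ ∑ B ∈ F, (B.card - 1) * (B.card - 2) := by
    calc _ ≤ (F.biUnion (fun B => nonAdjPairs G B)).card := by
          apply Finset.card_le_card
          intro p hp
          simp only [nonAdjPairs, Finset.mem_filter, Finset.mem_product, Finset.mem_univ,
            true_and, Finset.mem_biUnion] at hp ⊢
          obtain ⟨B, hB, h1, h2⟩ := hF.2 _ _ hp.1 hp.2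
          exact ⟨B, hB, ⟨h1, h2⟩, hp⟩
      _ ≤ _ := Finset.card_biUnion_le
      _ ≤ _ := Finset.sum_le_sum hNB
  obtain ⟨T, hT, hTD⟩ : ∃ T ∈ F, D + 1 ≤ T.card := by
    by_contra hno
    push Not at hno
    have h1 : ∑ B ∈ F, (B.card - 1) * (B.card - 2) ≤ ∑ B ∈ F, (D - 1) * (B.card - 2) := by
      apply Finset.sum_le_sum
      intro B hB
      have := hno B hB
      exact Nat.mul_le_mul_right _ (by omega)
    rw [← Finset.mul_sum] at h1
    have h2 := Nat.mul_le_mul_left (D - 1) hsum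
    rcases Nat.eq_zero_or_pos D with h0 | h0
    · have hFe : F = ∅ := by
        rw [Finset.eq_empty_iff_forall_notMem]
        intro B hB
        have := hno B hB
        have := (hF.1 B hB).1
        omega
      have hcov := hF.2
      simp only [hFe, Finset.notMem_empty, false_and, exists_false, imp_false, not_not] at hcov
      obtain ⟨a, b, hab⟩ := Fintype.exists_pair_of_one_lt_card (α := V) (by omega)
      have := hD a {b} (by simpa using hcov a b hab)
      simp at this; omega
    · obtain ⟨d, rfl⟩ : ∃ d, D = d + 1 := ⟨D - 1, by omega⟩
      simp only [Nat.add_sub_cancel] at h1 h2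
      have : (Fintype.card V - 3) * (d + 1) = d * (Fintype.card V - 3) + (Fintype.card V - 3) := by
        ring
      omega
  set F' := (F.erase T).filter (fun S => (S ∩ T).Nonempty) with hF'
  have hmemF' : ∀ S, S ∈ F' ↔ S ≠ T ∧ S ∈ F ∧ (S ∩ T).Nonempty := by
    intro S; simp [hF', and_assoc]
  have key : ∀ v ∈ Tᶜ, 2 ≤ (F'.filter (fun S => v ∈ S)).card := by
    intro v hv
    have hv : v ∉ T := by simpa using hv
    -- a nonneighbor gives a set
    have hget : ∀ w ∈ T, ¬ G.Adj v w → ∃ S ∈ F', v ∈ S ∧ w ∈ S := by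
      intro w hw hvw
      obtain ⟨S, hS, h1, h2⟩ := hF.2 v w (by rintro rfl; exact hv hw) hvw
      exact ⟨S, (hmemF' S).2 ⟨by rintro rfl; exact hv h1, hS, w, by simp [h2, hw]⟩, h1, h2⟩
    set A := T.filter (fun x => G.Adj v x)
    set A' := T.filter (fun x => ¬ G.Adj v x) with hA'
    have hAA : A.card + A'.card = T.card := Finset.card_filter_add_card_filter_not _
    have hAD : A.card ≤ D := hD v A (by intro x hx; exact (Finset.mem_filter.1 hx).2)
    have hA'pos : 0 < A'.card := by omega
    obtain ⟨w, hw⟩ := Finset.card_pos.1 hA'pos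
    obtain ⟨hwT, hvw⟩ := Finset.mem_filter.1 hw
    obtain ⟨S, hSF', hvS, hwS⟩ := hget w hwT hvw
    obtain ⟨hST, hSF, -⟩ := (hmemF' S).1 hSF'
    obtain ⟨z, hzS, hvz⟩ : ∃ z ∈ S, G.Adj v z := by
      have hc := (hF.1 S hSF).2
      have : Nontrivial (S : Set V) := ⟨⟨v, hvS⟩, ⟨w, hwS⟩, by
        intro h; apply hv; have := congrArg Subtype.val h; simp at this; rw [this]; exact hwT⟩
      obtain ⟨z, hz⟩ := hc.exists_adj_of_nontrivial ⟨v, hvS⟩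
      exact ⟨z, z.2, hz⟩
    have hzT : z ∉ T := by
      intro hzT
      have := hlin S hSF T hT hST z hzS hzT w hwS hwT
      rw [this] at hvz
      exact hvw hvz
    have hAD' : (insert z A).card ≤ D := hD v _ (by
      intro x hx
      rcases Finset.mem_insert.1 hx with rfl | hx
      · exact hvz
      · exact (Finset.mem_filter.1 hx).2)
    rw [Finset.card_insert_of_notMem (by intro h; exact hzT (Finset.mem_filter.1 h).1)] at hAD'
    obtain ⟨w', hw', hne⟩ := Finset.exists_mem_ne (s := A') (by omega) w
    obtain ⟨hwT', hvw'⟩ := Finset.mem_filter.1 hw'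
    obtain ⟨S', hSF'', hvS', hwS'⟩ := hget w' hwT' hvw'
    refine Finset.one_lt_card.2 ⟨S, by simp [hSF', hvS], S', by simp [hSF'', hvS'], ?_⟩
    rintro rfl
    exact hne (hlin S hSF T hT hST w' hwS' hwT' w hwS hwT)
  have dc := Finset.sum_card_bipartiteAbove_eq_sum_card_bipartiteBelow
    (s := Tᶜ) (t := F') (fun v S => v ∈ S)
  have hle : 2 * Tᶜ.card ≤ ∑ S ∈ F', 2 * (S.card - 2) := by
    calc 2 * Tᶜ.card = ∑ v ∈ Tᶜ, 2 := by rw [Finset.sum_const]; simp [mul_comm]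
      _ ≤ ∑ v ∈ Tᶜ, (F'.filter (fun S => v ∈ S)).card := Finset.sum_le_sum key
      _ = ∑ S ∈ F', (Tᶜ.filter (fun v => v ∈ S)).card := dc
      _ ≤ _ := by
        apply Finset.sum_le_sum
        intro S hS
        obtain ⟨hST, hSF, x, hx⟩ := (hmemF' S).1 hS
        have h3 := (hF.1 S hSF).1
        obtain ⟨hxS, hxT⟩ := Finset.mem_inter.1 hx
        have : Tᶜ.filter (fun v => v ∈ S) ⊆ S.erase x := by
          intro y hy
          obtain ⟨hy1, hy2⟩ := Finset.mem_filter.1 hy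
          refine Finset.mem_erase.2 ⟨?_, hy2⟩
          rintro rfl
          exact (Finset.mem_compl.1 hy1) hxT
        have := Finset.card_le_card this
        rw [Finset.card_erase_of_mem hxS] at this
        omega
  rw [← Finset.mul_sum] at hle
  have hsub : ∑ S ∈ F', (S.card - 2) + (T.card - 2) ≤ ∑ B ∈ F, (B.card - 2) := by
    rw [← Finset.sum_erase_add _ _ hT]
    exact Nat.add_le_add_right (Finset.sum_le_sum_of_subset (Finset.filter_subset _ _)) _
  have := Finset.card_add_card_compl T
  have := (hF.1 T hT).1
  omega

/-- the edges of color `c` -/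
def colorGraph {V : Type*} (G : SimpleGraph V) (ce : Sym2 V → ℕ) (c : ℕ) : SimpleGraph V where
  Adj u v := G.Adj u v ∧ ce s(u, v) = c
  symm := ⟨fun u v h => ⟨h.1.symm, by rw [Sym2.eq_swap]; exact h.2⟩⟩
  loopless := ⟨fun u h => h.1.ne rfl⟩

noncomputable def compOf {V : Type*} [Fintype V] (H : SimpleGraph V) (v : V) : Finset V := by
  classical exact Finset.univ.filter (fun x => H.Reachable v x)

lemma mem_compOf {V : Type*} [Fintype V] {H : SimpleGraph V} {v x : V} :
    x ∈ compOf H v ↔ H.Reachable v x := by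
  classical simp [compOf]

noncomputable def bigComps {V : Type*} [Fintype V] (H : SimpleGraph V) : Finset (Finset V) := by
  classical exact (Finset.univ.image (compOf H)).filter (fun B => 3 ≤ B.card)

lemma mem_bigComps {V : Type*} [Fintype V] {H : SimpleGraph V} {B : Finset V} :
    B ∈ bigComps H ↔ (∃ v, compOf H v = B) ∧ 3 ≤ B.card := by
  classical simp [bigComps]

lemma compOf_preconnected {V : Type*} [Fintype V] (H : SimpleGraph V) (v : V) :
    (H.induce (compOf H v : Set V)).Preconnected := by
  have h := (H.connectedComponentMk v).connected_toSimpleGraph.preconnected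
  have : (compOf H v : Set V) = (H.connectedComponentMk v).supp := by
    ext x
    simp only [Finset.mem_coe, mem_compOf, SimpleGraph.ConnectedComponent.mem_supp_iff,
      SimpleGraph.ConnectedComponent.eq]
    exact ⟨fun h => h.symm, fun h => h.symm⟩
  rw [this]
  exact h

lemma bigComps_sum {V : Type*} [Fintype V] (H : SimpleGraph V) (hne : H.edgeSet.Nonempty) :
    1 + ∑ B ∈ bigComps H, (B.card - 2) ≤ H.edgeSet.ncard := by
  classical
  have hfin : H.edgeSet.Finite := Set.toFinite _
  rcases (bigComps H).eq_empty_or_nonempty with h0 | h0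
  · rw [h0, Finset.sum_empty]
    exact (Set.ncard_pos hfin).2 hne
  have hdisj : ((bigComps H : Finset (Finset V)) : Set (Finset V)).PairwiseDisjoint
      (edgesIn H) := by
    intro B hB B' hB' hBB'
    obtain ⟨⟨v, rfl⟩, -⟩ := mem_bigComps.1 hB
    obtain ⟨⟨v', rfl⟩, -⟩ := mem_bigComps.1 hB'
    rw [Function.onFun, Finset.disjoint_left]
    intro e he he'
    apply hBB'
    induction e with | _ a b =>
    have h1 := mem_compOf.1 ((mem_edgesIn.1 he).2 a (by simp))
    have h2 := mem_compOf.1 ((mem_edgesIn.1 he').2 a (by simp))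
    ext x
    rw [mem_compOf, mem_compOf]
    exact ⟨fun h => h2.trans (h1.symm.trans h), fun h => h1.trans (h2.symm.trans h)⟩
  have h1 : ∑ B ∈ bigComps H, (edgesIn H B).card ≤ H.edgeSet.ncard := by
    rw [← Finset.card_biUnion hdisj, ← Set.ncard_coe_finset]
    apply Set.ncard_le_ncard _ hfin
    intro e he
    obtain ⟨B, -, hB⟩ := Finset.mem_biUnion.1 (Finset.mem_coe.1 he)
    exact (mem_edgesIn.1 hB).1
  have h2 : ∑ B ∈ bigComps H, ((B.card - 2) + 1) ≤ ∑ B ∈ bigComps H, (edgesIn H B).card := by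
    apply Finset.sum_le_sum
    intro B hB
    obtain ⟨⟨v, rfl⟩, h3⟩ := mem_bigComps.1 hB
    have := card_le_edgesIn H (compOf H v) (Finset.card_pos.1 (by omega)) (compOf_preconnected H v)
    omega
  rw [Finset.sum_add_distrib, Finset.sum_const] at h2
  have := Finset.card_pos.2 h0
  simp only [smul_eq_mul, mul_one] at h2
  omega

lemma color_family {V : Type*} [Fintype V] (G : SimpleGraph V) (ce : Sym2 V → ℕ)
    (hmc : ∀ u v, u ≠ v → ∃ w : G.Walk u v, ∃ c, ∀ e ∈ w.edges, ce e = c) :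
    ∃ F, FamOK G F ∧ (ce '' G.edgeSet).ncard + ∑ B ∈ F, (B.card - 2) ≤ G.edgeSet.ncard := by
  classical
  have hsub : ∀ c, colorGraph G ce c ≤ G := fun c u v h => h.1
  set C := G.edgeFinset.image ce with hC
  refine ⟨C.biUnion (fun c => bigComps (colorGraph G ce c)), ⟨?_, ?_⟩, ?_⟩
  · intro B hB
    obtain ⟨c, -, hB⟩ := Finset.mem_biUnion.1 hB
    obtain ⟨⟨v, rfl⟩, h3⟩ := mem_bigComps.1 hB
    refine ⟨h3, (compOf_preconnected _ v).mono ?_⟩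
    intro a b h
    exact hsub c h
  · intro u v huv hadj
    obtain ⟨w, c, hw⟩ := hmc u v huv
    have hr : (colorGraph G ce c).Reachable u v := by
      refine ⟨w.transfer _ ?_⟩
      intro e he
      have h1 := w.edges_subset_edgeSet he
      have h2 := hw e he
      induction e with | _ a b => exact ⟨h1, h2⟩
    refine ⟨compOf (colorGraph G ce c) u, ?_, mem_compOf.2 (SimpleGraph.Reachable.refl _),
      mem_compOf.2 hr⟩
    rw [Finset.mem_biUnion]
    cases w with
    | nil => exact absurd rfl huv
    | cons h p =>
      rename_i x
      have hcx : ce s(u, x) = c := hw _ (by simp)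
      refine ⟨c, ?_, mem_bigComps.2 ⟨⟨u, rfl⟩, ?_⟩⟩
      · rw [hC, Finset.mem_image]
        exact ⟨s(u, x), by simpa using h, hcx⟩
      · have hxv : x ≠ v := by rintro rfl; exact hadj h
        have hux : (colorGraph G ce c).Reachable u x := SimpleGraph.Adj.reachable ⟨h, hcx⟩
        have : ({u, x, v} : Finset V) ⊆ compOf (colorGraph G ce c) u := by
          intro y hy
          simp only [Finset.mem_insert, Finset.mem_singleton] at hy
          rw [mem_compOf]
          rcases hy with rfl | rfl | rfl
          · exact SimpleGraph.Reachable.refl _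
          · exact hux
          · exact hr
        have h3 := Finset.card_le_card this
        rwa [Finset.card_eq_three.2 ⟨u, x, v, h.ne, huv, hxv, rfl⟩] at h3
  · have hm : G.edgeSet.ncard = G.edgeFinset.card := by
      rw [← SimpleGraph.coe_edgeFinset, Set.ncard_coe_finset]
    have hcc : (ce '' G.edgeSet).ncard = C.card := by
      rw [← Set.ncard_coe_finset, hC, Finset.coe_image, SimpleGraph.coe_edgeFinset]
    rw [hm, hcc, Finset.card_eq_sum_card_image ce G.edgeFinset, ← hC]
    have h1 : ∑ B ∈ C.biUnion (fun c => bigComps (colorGraph G ce c)), (B.card - 2) ≤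
        ∑ c ∈ C, ∑ B ∈ bigComps (colorGraph G ce c), (B.card - 2) := by
      clear hcc hC
      clear_value C
      induction C using Finset.induction_on with
      | empty => simp
      | insert a s ha ih =>
        rw [Finset.biUnion_insert, Finset.sum_insert ha]
        refine le_trans ?_ (Nat.add_le_add_left ih _)
        rw [← Finset.sum_union_inter]
        exact Nat.le_add_right _ _
    have h2 : ∑ c ∈ C, (1 + ∑ B ∈ bigComps (colorGraph G ce c), (B.card - 2)) ≤
        ∑ c ∈ C, (G.edgeFinset.filter (fun e => ce e = c)).card := by
      apply Finset.sum_le_sum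
      intro c hc
      have he : (colorGraph G ce c).edgeSet =
          ((G.edgeFinset.filter (fun e => ce e = c) : Finset (Sym2 V)) : Set (Sym2 V)) := by
        ext e
        induction e with | _ a b => simp [colorGraph]
      rw [← Set.ncard_coe_finset, ← he]
      apply bigComps_sum
      rw [he]
      obtain ⟨e, he1, he2⟩ := Finset.mem_image.1 hc
      exact ⟨e, by simpa using ⟨by simpa using he1, he2⟩⟩
    rw [Finset.sum_add_distrib, Finset.sum_const] at h2
    simp only [smul_eq_mul, mul_one] at h2
    omega

lemma tree_of_cds {V : Type*} [Fintype V] (G : SimpleGraph V) (hn : 1 < Fintype.card V) (Q : Set V)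
    (hQ : Q.Nonempty)
    (hc : (G.induce Q).Preconnected) (hd : ∀ u, u ∉ Q → ∃ q ∈ Q, G.Adj u q) :
    ∃ T : SimpleGraph V, T ≤ G ∧ T.IsTree ∧ Qᶜ.ncard ≤ numLeaves T := by
  classical
  choose! f hfQ hf using hd
  let H : SimpleGraph V :=
    { Adj := fun a b => G.Adj a b ∧ ((a ∈ Q ∧ b ∈ Q) ∨ (a ∉ Q ∧ b = f a) ∨ (b ∉ Q ∧ a = f b))
      symm := ⟨fun a b h => ⟨h.1.symm, by tauto⟩⟩
      loopless := ⟨fun a h => h.1.ne rfl⟩ }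
  obtain ⟨q0, hq0⟩ := hQ
  have hHQ : ∀ a ∈ Q, H.Reachable a q0 := by
    intro a ha
    let φ : G.induce Q →g H :=
      { toFun := Subtype.val
        map_rel' := fun {a b} h => ⟨h, Or.inl ⟨a.2, b.2⟩⟩ }
    exact (hc ⟨a, ha⟩ ⟨q0, hq0⟩).map φ
  have hH0 : ∀ a, H.Reachable a q0 := by
    intro a
    by_cases ha : a ∈ Q
    · exact hHQ a ha
    · have : H.Adj a (f a) := ⟨hf a ha, Or.inr (Or.inl ⟨ha, rfl⟩)⟩
      exact this.reachable.trans (hHQ _ (hfQ a ha))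
  have hne : Nonempty V := ⟨q0⟩
  have hconn : H.Connected := ⟨fun a b => (hH0 a).trans (hH0 b).symm⟩
  obtain ⟨T, hTH, hT⟩ := hconn.exists_isTree_le
  refine ⟨T, fun a b h => (hTH h).1, hT, ?_⟩
  apply Set.ncard_le_ncard _ (Set.toFinite _)
  intro u hu
  have hu : u ∉ Q := hu
  have hnt : Nontrivial V := Fintype.one_lt_card_iff_nontrivial.1 hn
  obtain ⟨z, hz⟩ := hT.connected.preconnected.exists_adj_of_nontrivial u
  have huniq : ∀ y, T.Adj u y → y = f u := by
    intro y hy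
    obtain ⟨-, h | h | h⟩ := hTH hy
    · exact absurd h.1 hu
    · exact h.2
    · exact absurd (h.2 ▸ hfQ y h.1) hu
  change (T.neighborSet u).ncard = 1
  rw [Set.ncard_eq_one]
  refine ⟨f u, ?_⟩
  ext y
  constructor
  · exact fun h => huniq y h
  · rintro rfl
    rw [← huniq z hz]; exact hz

lemma mem_internal {V : Type*} {G : SimpleGraph V} {u v : V} (w : G.Walk u v) {x : V}
    (hx : x ∈ w.support) : x = u ∨ x = v ∨ x ∈ w.support.tail.dropLast := by
  cases w with
  | nil => simp at hx; exact Or.inl hx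
  | cons h p =>
    rw [SimpleGraph.Walk.support_cons, List.mem_cons] at hx
    rcases hx with rfl | hx
    · exact Or.inl rfl
    · right
      rw [SimpleGraph.Walk.support_cons, List.tail_cons]
      have hne : p.support ≠ [] := p.support_ne_nil
      rw [← List.dropLast_append_getLast hne, List.mem_append] at hx
      rcases hx with hx | hx
      · exact Or.inr hx
      · left; simpa using hx

lemma internal_getVert {V : Type*} {G : SimpleGraph V} {u v : V} (w : G.Walk u v) {x : V}
    (hx : x ∈ w.support.tail.dropLast) : ∃ i, i ≠ 0 ∧ i < w.length ∧ w.getVert i = x := by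
  obtain ⟨j, hj, rfl⟩ := List.getElem_of_mem hx
  simp only [List.length_dropLast, List.length_tail, SimpleGraph.Walk.length_support] at hj
  refine ⟨j + 1, by omega, by omega, ?_⟩
  rw [List.getElem_dropLast, List.getElem_tail, SimpleGraph.Walk.getVert_eq_support_getElem]
  omega

lemma tree_coloring {V : Type*} [Fintype V] (G T : SimpleGraph V) (hn : 1 < Fintype.card V)
    (hTG : T ≤ G) (hT : T.IsTree) :
    ∃ ce cv, IsTMCColoring G ce cv ∧
      G.edgeSet.ncard + 2 + numLeaves T ≤ colorsUsed G ce cv + Fintype.card V := by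
  classical
  obtain ⟨f, hf⟩ := exists_injective_nat (Sym2 V ⊕ V)
  let ce : Sym2 V → ℕ := fun e => if e ∈ T.edgeSet then 0 else f (Sum.inl e) + 1
  let cv : V → ℕ := fun v => if (T.neighborSet v).ncard = 1 then f (Sum.inr v) + 1 else 0
  refine ⟨ce, cv, ?_, ?_⟩
  · intro u v huv
    obtain ⟨p, hp⟩ := (hT.connected.preconnected u v).exists_isPath
    refine ⟨p.mapLe hTG, hp.mapLe hTG, 0, ?_, ?_⟩
    · intro e he
      rw [SimpleGraph.Walk.edges_mapLe_eq_edges] at he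
      exact if_pos (p.edges_subset_edgeSet he)
    · intro x hx
      rw [SimpleGraph.Walk.support_mapLe_eq_support] at hx
      obtain ⟨i, h0, hi, rfl⟩ := internal_getVert p hx
      apply if_neg
      have h2 := hp.ncard_neighborSet_toSubgraph_internal_eq_two h0 hi
      have h3 := Set.ncard_le_ncard (p.toSubgraph.neighborSet_subset (p.getVert i)) (Set.toFinite _)
      omega
  · have hfin : T.edgeSet.Finite := Set.toFinite _
    have hTe : T.edgeSet.ncard + 1 = Fintype.card V := by
      rw [← hT.card_edgeFinset, ← SimpleGraph.coe_edgeFinset, Set.ncard_coe_finset]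
    have hsubE : T.edgeSet ⊆ G.edgeSet := SimpleGraph.edgeSet_mono hTG
    have hdiff := Set.ncard_sdiff_add_ncard_of_subset hsubE (Set.toFinite _)
    let L : Set V := {v | (T.neighborSet v).ncard = 1}
    let S : Set (Sym2 V ⊕ V) := Sum.inl '' (G.edgeSet \ T.edgeSet) ∪ Sum.inr '' L
    have hS : S.ncard = (G.edgeSet \ T.edgeSet).ncard + numLeaves T := by
      rw [Set.ncard_union_eq _ (Set.toFinite _) (Set.toFinite _),
        Set.ncard_image_of_injective _ Sum.inl_injective,
        Set.ncard_image_of_injective _ Sum.inr_injective]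
      · rfl
      · rw [Set.disjoint_left]
        rintro _ ⟨a, -, rfl⟩ ⟨b, -, h⟩
        cases h
    have hg : Function.Injective (fun s => f s + 1) := fun a b h => hf (Nat.succ_injective h)
    have hle : (insert 0 ((fun s => f s + 1) '' S)).ncard ≤ colorsUsed G ce cv := by
      apply Set.ncard_le_ncard _ (Set.toFinite _)
      rintro c (rfl | ⟨s, hs, rfl⟩)
      · left
        have : T.edgeSet.Nonempty := (Set.ncard_pos hfin).1 (by omega)
        obtain ⟨e, he⟩ := this
        exact ⟨e, hsubE he, if_pos he⟩
      · rcases hs with ⟨e, he, rfl⟩ | ⟨v, hv, rfl⟩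
        · left; exact ⟨e, he.1, if_neg he.2⟩
        · right; exact ⟨v, if_pos hv⟩
    rw [Set.ncard_insert_of_notMem (by rintro ⟨s, -, h⟩; simp at h) (Set.toFinite _),
      Set.ncard_image_of_injective _ hg, hS] at hle
    omega

lemma numLeaves_le {V : Type*} [Fintype V] (T : SimpleGraph V) : numLeaves T ≤ Fintype.card V := by
  rw [← Nat.card_eq_fintype_card]
  exact Set.ncard_le_card _

lemma tmc_upper {V : Type*} [Fintype V] (G : SimpleGraph V) (hn : 1 < Fintype.card V)
    (hnc : ∃ u v, u ≠ v ∧ ¬ G.Adj u v)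
    (ce : Sym2 V → ℕ) (cv : V → ℕ) (h : IsTMCColoring G ce cv) :
    colorsUsed G ce cv ≤ (ce '' G.edgeSet).ncard + maxLeaves G := by
  classical
  let Q : Set V := {v | cv v ∈ ce '' G.edgeSet}
  have hint : ∀ u v, u ≠ v → ∃ w : G.Walk u v, ∀ x ∈ w.support.tail.dropLast, x ∈ Q := by
    intro u v huv
    obtain ⟨w, -, c, h1, h2⟩ := h u v huv
    refine ⟨w, ?_⟩
    intro x hx
    cases w with
    | nil => exact absurd rfl huv
    | cons hadj p =>
      rename_i y
      exact ⟨s(u, y), hadj, (h1 _ (by simp)).trans (h2 x hx).symm⟩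
  have hdom' : ∀ u v, u ≠ v → ¬ G.Adj u v → ∃ q ∈ Q, G.Adj u q := by
    intro u v huv hadj
    obtain ⟨w, hw⟩ := hint u v huv
    cases w with
    | nil => exact absurd rfl huv
    | cons h1 p =>
      rename_i y
      refine ⟨y, ?_, h1⟩
      apply hw
      cases p with
      | nil => exact absurd h1 hadj
      | cons h2 p =>
        simp only [SimpleGraph.Walk.support_cons, List.tail_cons]
        rw [List.dropLast_cons_of_ne_nil p.support_ne_nil]
        simp
  have hQne : Q.Nonempty := by
    obtain ⟨u, v, huv, hadj⟩ := hnc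
    obtain ⟨q, hq, -⟩ := hdom' u v huv hadj
    exact ⟨q, hq⟩
  have hdom : ∀ u, u ∉ Q → ∃ q ∈ Q, G.Adj u q := by
    intro u hu
    obtain ⟨q, hq⟩ := hQne
    by_cases hadj : G.Adj u q
    · exact ⟨q, hq, hadj⟩
    · exact hdom' u q (by rintro rfl; exact hu hq) hadj
  have hconn : (G.induce Q).Preconnected := by
    rintro ⟨u, hu⟩ ⟨v, hv⟩
    by_cases huv : u = v
    · subst huv; exact SimpleGraph.Reachable.refl _
    obtain ⟨w, hw⟩ := hint u v huv
    refine ⟨w.induce Q ?_⟩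
    intro x hx
    rcases mem_internal w hx with rfl | rfl | hx
    · exact hu
    · exact hv
    · exact hw x hx
  obtain ⟨T, hTG, hT, hL⟩ := tree_of_cds G hn Q hQne hconn hdom
  have hmax : numLeaves T ≤ maxLeaves G := by
    apply le_csSup
    · refine ⟨Fintype.card V, ?_⟩
      rintro k ⟨T', -, -, rfl⟩
      exact numLeaves_le T'
    · exact ⟨T, hTG, hT, rfl⟩
  have hsub : ce '' G.edgeSet ∪ Set.range cv ⊆ ce '' G.edgeSet ∪ cv '' Qᶜ := by
    rintro c (hc | ⟨v, rfl⟩)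
    · exact Or.inl hc
    · by_cases hv : v ∈ Q
      · exact Or.inl hv
      · exact Or.inr ⟨v, hv, rfl⟩
  calc colorsUsed G ce cv ≤ (ce '' G.edgeSet ∪ cv '' Qᶜ).ncard :=
        Set.ncard_le_ncard hsub (Set.toFinite _)
    _ ≤ (ce '' G.edgeSet).ncard + (cv '' Qᶜ).ncard := Set.ncard_union_le _ _
    _ ≤ _ := by
      have : (cv '' Qᶜ).ncard ≤ Qᶜ.ncard := Set.ncard_image_le (Set.toFinite _)
      omega

theorem stmt5 {V : Type*} [Fintype V] (G : SimpleGraph V) [DecidableRel G.Adj]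
    (hG : G.Connected) (hn : 3 < Fintype.card V)
    (hdeg : (G.maxDegree : ℚ) < (Fintype.card V : ℚ) -
      (2 * (G.edgeSet.ncard : ℚ) - 3 * ((Fintype.card V : ℚ) - 1)) /
        ((Fintype.card V : ℚ) - 3)) :
    (tmc G : ℤ) = (G.edgeSet.ncard : ℤ) - (Fintype.card V : ℤ) + 2 + (maxLeaves G : ℤ) := by
  classical
  set n := Fintype.card V with hndef
  set m := G.edgeSet.ncard with hmdef
  have hcount := card_adj_add_nonAdj G Finset.univ
  have hedges : (edgesIn G Finset.univ).card = m := by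
    rw [hmdef, ← Set.ncard_coe_finset]
    congr 1
    ext e
    simp [mem_edgesIn]
  rw [card_adjPairs, hedges, Finset.card_univ, ← hndef] at hcount
  have hD : ∀ v, ∀ S : Finset V, (∀ x ∈ S, G.Adj v x) → S.card ≤ G.maxDegree := by
    intro v S hS
    refine le_trans ?_ (G.degree_le_maxDegree v)
    rw [← SimpleGraph.card_neighborFinset_eq_degree]
    apply Finset.card_le_card
    intro x hx
    simpa using hS x hx
  have hnum : (n - 3) * G.maxDegree < (nonAdjPairs G Finset.univ).card + (n - 3) := by
    have hpos : (0 : ℚ) < (n : ℚ) - 3 := by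
      have : (3 : ℚ) < n := by exact_mod_cast hn
      linarith
    rw [lt_sub_iff_add_lt, ← lt_sub_iff_add_lt', div_lt_iff₀ hpos] at hdeg
    have hcq : 2 * (m : ℚ) + (nonAdjPairs G Finset.univ).card + n = n * n := by
      exact_mod_cast hcount
    have : ((n : ℚ) - 3) * G.maxDegree < (nonAdjPairs G Finset.univ).card + ((n : ℚ) - 3) := by
      nlinarith
    have h3 : ((n - 3 : ℕ) : ℚ) = (n : ℚ) - 3 := by
      rw [Nat.cast_sub hn.le]; norm_num
    rw [← h3] at this
    exact_mod_cast this
  have hnc : ∃ u v, u ≠ v ∧ ¬ G.Adj u v := by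
    by_contra hno
    push Not at hno
    have h0 : (nonAdjPairs G Finset.univ).card = 0 := by
      rw [Finset.card_eq_zero, Finset.eq_empty_iff_forall_notMem]
      intro p hp
      simp only [nonAdjPairs, Finset.mem_filter] at hp
      exact hp.2.2 (hno _ _ hp.2.1)
    obtain ⟨a, b, hab⟩ := Fintype.exists_pair_of_one_lt_card (α := V) (by omega)
    have h1 : 1 ≤ G.maxDegree := hD a {b} (by simpa using hno a b hab)
    have := Nat.mul_le_mul_left (n - 3) h1
    omega
  have hub : ∀ ce cv, IsTMCColoring G ce cv → colorsUsed G ce cv + n ≤ m + 2 + maxLeaves G := by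
    intro ce cv h
    have h1 := tmc_upper G (by omega) hnc ce cv h
    obtain ⟨F, hF, hFs⟩ := color_family G ce (by
      intro u v huv
      obtain ⟨w, -, c, hw, -⟩ := h u v huv
      exact ⟨w, c, hw⟩)
    obtain ⟨F', hF', hlin, hs⟩ := exists_linear G F.card F le_rfl hF
    have h2 := linear_bound G G.maxDegree hD (by omega) hnum F' hF' hlin
    omega
  obtain ⟨T, hTG, hT, hTl⟩ : ∃ T : SimpleGraph V, T ≤ G ∧ T.IsTree ∧ numLeaves T = maxLeaves G := by
    have := Nat.sSup_mem (s := {k | ∃ T : SimpleGraph V, T ≤ G ∧ T.IsTree ∧ numLeaves T = k})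
      (by
        obtain ⟨T, h1, h2⟩ := hG.exists_isTree_le
        exact ⟨_, T, h1, h2, rfl⟩)
      ⟨Fintype.card V, by
        rintro k ⟨T', -, -, rfl⟩
        exact numLeaves_le T'⟩
    exact this
  obtain ⟨ce, cv, hcol, hlow⟩ := tree_coloring G T (by omega) hTG hT
  have h1 : colorsUsed G ce cv ≤ tmc G := by
    apply le_csSup
    · refine ⟨m + 2 + maxLeaves G, ?_⟩
      rintro k ⟨ce, cv, h, rfl⟩
      have := hub ce cv h
      omega
    · exact ⟨ce, cv, hcol, rfl⟩
  have h2 : tmc G ≤ m + 2 + maxLeaves G - n := by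
    apply csSup_le
    · exact ⟨_, ce, cv, hcol, rfl⟩
    · rintro k ⟨ce, cv, h, rfl⟩
      have := hub ce cv h
      omega
  have h3 := hub ce cv hcol
  rw [hTl] at hlow
  omega
end

section
/- Let n, t, s be integers with 2 ≤ t ≤ n − 2 and 0 ≤ s ≤ t − 1, and let G = G_{t,s} be the n-vertex graph constructed as follows: take the complete graph K_{t+1}, replace one of its edges uv by a path with n − t edges between u and v, and then delete s edges joining u to vertices of V(K_{t+1}) \ {u, v}. Then G has m = n + C(t,2) − 1 − s edges, l(G) = t, and tmc(G) = m − n + 2 + l(G). -/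
open SimpleGraph

/-- The graph `G_{t,s}` on vertex set `Fin n`: take a complete graph on `{0, …, t}`,
replace the edge between `u = 0` and `v = t` by a path `0, t+1, t+2, …, n-1, t`
with `n - t` edges, and delete the `s` edges joining `0` to the vertices `1, …, s`. -/
def Gts (n t s : ℕ) : SimpleGraph (Fin n) :=
  SimpleGraph.fromRel (fun i j =>
    ((i : ℕ) ≤ t ∧ (j : ℕ) ≤ t
        ∧ ¬((i : ℕ) = 0 ∧ (j : ℕ) = t) ∧ ¬((j : ℕ) = 0 ∧ (i : ℕ) = t)
        ∧ ¬((i : ℕ) = 0 ∧ 1 ≤ (j : ℕ) ∧ (j : ℕ) ≤ s)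
        ∧ ¬((j : ℕ) = 0 ∧ 1 ≤ (i : ℕ) ∧ (i : ℕ) ≤ s))
    ∨ ((i : ℕ) = 0 ∧ (j : ℕ) = t + 1)
    ∨ (t + 1 ≤ (i : ℕ) ∧ (j : ℕ) = (i : ℕ) + 1 ∧ (i : ℕ) + 1 ≤ n - 1)
    ∨ ((i : ℕ) = n - 1 ∧ (j : ℕ) = t))


namespace TMCaux

/-- subgraph of edges of color `c` -/
def Hc {V : Type*} (G : SimpleGraph V) (ce : Sym2 V → ℕ) (c : ℕ) : SimpleGraph V where
  Adj a b := G.Adj a b ∧ ce s(a, b) = c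
  symm := ⟨fun a b h => ⟨h.1.symm, by rw [Sym2.eq_swap]; exact h.2⟩⟩
  loopless := ⟨fun a h => G.loopless.irrefl a h.1⟩

/-- number of edges of color `c` -/
noncomputable def EC {V : Type*} (G : SimpleGraph V) (ce : Sym2 V → ℕ) (c : ℕ) : ℕ :=
  {e | e ∈ G.edgeSet ∧ ce e = c}.ncard

/-- number of vertices of color `c` -/
noncomputable def VC {V : Type*} (cv : V → ℕ) (c : ℕ) : ℕ :=
  {v | cv v = c}.ncard

lemma count_colors {V : Type*} [Fintype V] (G : SimpleGraph V) (ce : Sym2 V → ℕ) (cv : V → ℕ)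
    (C : Finset ℕ) :
    colorsUsed G ce cv + ∑ c ∈ C, (EC G ce c + VC cv c - 1) ≤
      G.edgeSet.ncard + Fintype.card V := by
  classical
  set U : Finset ℕ := G.edgeFinset.image ce ∪ Finset.univ.image cv with hU
  have h1 : colorsUsed G ce cv = U.card := by
    unfold colorsUsed
    rw [← Set.ncard_coe_finset]
    congr 1
    ext c
    simp [hU]
  have hE : ∀ c, EC G ce c = (G.edgeFinset.filter (fun e => ce e = c)).card := by
    intro c
    unfold EC
    rw [← Set.ncard_coe_finset]
    congr 1
    ext e
    simp
  have hV : ∀ c, VC cv c = (Finset.univ.filter (fun v => cv v = c)).card := by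
    intro c
    unfold VC
    rw [← Set.ncard_coe_finset]
    congr 1
    ext e
    simp
  have h2 : G.edgeSet.ncard = ∑ c ∈ U, EC G ce c := by
    have : G.edgeSet.ncard = G.edgeFinset.card := by
      rw [← Set.ncard_coe_finset]; simp
    rw [this, Finset.card_eq_sum_card_fiberwise (f := ce) (t := U)]
    · simp [hE]
    · intro e he
      simp only [hU, Finset.coe_union, Finset.coe_image]
      exact Or.inl ⟨e, he, rfl⟩
  have h3 : Fintype.card V = ∑ c ∈ U, VC cv c := by
    rw [← Finset.card_univ, Finset.card_eq_sum_card_fiberwise (f := cv) (t := U)]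
    · simp [hV]
    · intro e he
      simp only [hU, Finset.coe_union, Finset.coe_image]
      exact Or.inr ⟨e, he, rfl⟩
  have h4 : ∀ c ∈ U, 1 ≤ EC G ce c + VC cv c := by
    intro c hc
    rw [hU, Finset.mem_union, Finset.mem_image, Finset.mem_image] at hc
    rcases hc with ⟨e, he, rfl⟩ | ⟨v, he, rfl⟩
    · have : 0 < EC G ce (ce e) := by
        rw [hE]; exact Finset.card_pos.2 ⟨e, Finset.mem_filter.2 ⟨he, rfl⟩⟩
      omega
    · have : 0 < VC cv (cv v) := by
        rw [hV]; exact Finset.card_pos.2 ⟨v, by simp⟩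
      omega
  have h5 : ∀ c, c ∉ U → EC G ce c + VC cv c = 0 := by
    intro c hc
    have a : EC G ce c = 0 := by
      rw [hE, Finset.card_eq_zero, Finset.filter_eq_empty_iff]
      rintro e he rfl
      exact hc (Finset.mem_union_left _ (Finset.mem_image_of_mem _ he))
    have b : VC cv c = 0 := by
      rw [hV, Finset.card_eq_zero, Finset.filter_eq_empty_iff]
      rintro e he rfl
      exact hc (Finset.mem_union_right _ (Finset.mem_image_of_mem _ he))
    omega
  have h6 : ∑ c ∈ C, (EC G ce c + VC cv c - 1) ≤ ∑ c ∈ U, (EC G ce c + VC cv c - 1) := by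
    apply Finset.sum_le_sum_of_ne_zero
    intro c _ hc
    by_contra hh
    rw [h5 c hh] at hc
    simp at hc
  have h7 : ∑ c ∈ U, (EC G ce c + VC cv c) = U.card + ∑ c ∈ U, (EC G ce c + VC cv c - 1) := by
    rw [Finset.card_eq_sum_ones, ← Finset.sum_add_distrib]
    apply Finset.sum_congr rfl
    intro c hc
    have := h4 c hc
    omega
  rw [Finset.sum_add_distrib] at h7
  omega

lemma reach_edges {V : Type*} [Fintype V] (G : SimpleGraph V) (ce : Sym2 V → ℕ) (c : ℕ)
    (r : V) (W : Finset V) (hr : r ∉ W) (hW : ∀ w ∈ W, (Hc G ce c).Reachable r w) :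
    W.card ≤ EC G ce c := by
  classical
  have key : ∀ w ∈ W, ∃ y, (Hc G ce c).Adj w y ∧ (Hc G ce c).dist y r < (Hc G ce c).dist w r := by
    intro w hw
    obtain ⟨q, hq⟩ := (hW w hw).symm.exists_walk_length_eq_dist
    cases q with
    | nil => exact absurd hw hr
    | cons h q =>
      refine ⟨_, h, ?_⟩
      rw [← hq, Walk.length_cons]
      exact Nat.lt_succ_of_le (SimpleGraph.dist_le q)
  choose! y hy using key
  unfold EC
  rw [← Set.ncard_coe_finset]
  apply Set.ncard_le_ncard_of_injOn (fun w => s(w, y w))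
  · intro w hw
    exact ⟨(hy w hw).1.1, (hy w hw).1.2⟩
  · intro w hw w' hw' h
    simp only [Sym2.eq_iff] at h
    rcases h with h | ⟨h1, h2⟩
    · exact h.1
    · have a := (hy w hw).2
      have b := (hy w' hw').2
      rw [h2] at a
      rw [← h1] at b
      omega

lemma verts_le {V : Type*} [Fintype V] (cv : V → ℕ) (c : ℕ)
    (W : Finset V) (hW : ∀ w ∈ W, cv w = c) : W.card ≤ VC cv c := by
  unfold VC
  rw [← Set.ncard_coe_finset]
  exact Set.ncard_le_ncard (fun w hw => hW w hw) (Set.toFinite _)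

lemma mem_internal {V : Type*} {G : SimpleGraph V} {u v x : V} (w : G.Walk u v)
    (hx : x ∈ w.support) (hu : x ≠ u) (hv : x ≠ v) : x ∈ w.support.tail.dropLast := by
  cases w with
  | nil => simp at hx; exact absurd hx hu
  | cons h q =>
    simp only [Walk.support_cons, List.mem_cons, List.tail_cons] at hx ⊢
    rcases hx with hx | hx
    · exact absurd hx hu
    · have := List.dropLast_append_getLast (q.support_ne_nil)
      rw [← this, List.mem_append] at hx
      rcases hx with hx | hx
      · exact hx
      · simp at hx; exact absurd hx hv

lemma tmc_cut {V : Type*} {G : SimpleGraph V} {ce : Sym2 V → ℕ} {cv : V → ℕ}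
    (h : IsTMCColoring G ce cv) {u v : V} (huv : u ≠ v) :
    ∃ c, (Hc G ce c).Reachable u v ∧ ∀ S : Set V, u ∈ S → v ∉ S →
      ∃ a b, a ∈ S ∧ b ∉ S ∧ G.Adj a b ∧ ce s(a, b) = c ∧ (a = u ∨ cv a = c) ∧
        (b = v ∨ cv b = c) := by
  obtain ⟨w, _, c, hce, hcv⟩ := h u v huv
  refine ⟨c, ?_, ?_⟩
  · refine ⟨w.transfer (Hc G ce c) ?_⟩
    intro e he
    have h1 := w.edges_subset_edgeSet he
    have h2 := hce e he
    induction e with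
    | _ a b => exact ⟨h1, h2⟩
  · intro S hu hv
    obtain ⟨d, hd, h1, h2⟩ := w.exists_boundary_dart S hu hv
    refine ⟨d.fst, d.snd, h1, h2, d.adj, ?_, ?_, ?_⟩
    · exact hce _ (List.mem_map_of_mem hd)
    · by_cases hh : d.fst = u
      · exact Or.inl hh
      · right
        apply hcv
        apply mem_internal w (w.dart_fst_mem_support_of_mem_darts hd) hh
        rintro rfl; exact hv h1
    · by_cases hh : d.snd = v
      · exact Or.inl hh
      · right
        apply hcv
        refine mem_internal w (w.dart_snd_mem_support_of_mem_darts hd) ?_ hh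
        rintro hh; rw [hh] at h2; exact h2 hu

section main
variable {V : Type*} [Fintype V] {G : SimpleGraph V} {ce : Sym2 V → ℕ} {cv : V → ℕ}
  {x : ℕ → V} {p : ℕ} {A : Finset V}

def Left (ce : Sym2 V → ℕ) (cv : V → ℕ) (x : ℕ → V) (i c : ℕ) : Prop :=
  ∀ k < i, ce s(x k, x (k+1)) = c ∧ cv (x k) = c

def Right (ce : Sym2 V → ℕ) (cv : V → ℕ) (x : ℕ → V) (p j c : ℕ) : Prop :=
  ∀ k, j ≤ k → k ≤ p → ce s(x k, x (k+1)) = c ∧ cv (x (k+1)) = c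

lemma left_reach (hadj : ∀ k ≤ p, G.Adj (x k) (x (k+1))) {i c : ℕ} (hi : i ≤ p + 1)
    (h : Left ce cv x i c) : ∀ k ≤ i, (Hc G ce c).Reachable (x 0) (x k) := by
  intro k
  induction k with
  | zero => intro _; exact Reachable.refl _
  | succ k ih =>
    intro hk
    refine (ih (by omega)).trans (Adj.reachable ?_)
    exact ⟨hadj k (by omega), (h k (by omega)).1⟩

lemma right_reach (hadj : ∀ k ≤ p, G.Adj (x k) (x (k+1))) {j c : ℕ}
    (h : Right ce cv x p j c) : ∀ d k, j ≤ k → k + d = p + 1 →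
      (Hc G ce c).Reachable (x (p+1)) (x k) := by
  intro d
  induction d with
  | zero => intro k _ hk; have : k = p + 1 := by omega
            rw [this]
  | succ d ih =>
    intro k hk hd
    refine (ih (k+1) (by omega) (by omega)).trans (Adj.reachable ?_)
    exact SimpleGraph.Adj.symm ⟨hadj k (by omega), (h k hk (by omega)).1⟩

lemma sideL (hadj : ∀ k ≤ p, G.Adj (x k) (x (k+1)))
    (hinj : Set.InjOn x (Set.Iic (p+1))) (hxA : ∀ k ≤ p + 1, x k ∉ A)
    {i c : ℕ} (hi : i ≤ p) (h : Left ce cv x i c)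
    (A1 : Finset V) (hA1 : A1 ⊆ A) (hr : ∀ a ∈ A1, (Hc G ce c).Reachable (x 0) a) :
    i + A1.card ≤ EC G ce c ∧ i ≤ VC cv c ∧
    ((Hc G ce c).Reachable (x 0) (x (p+1)) → i + A1.card + 1 ≤ EC G ce c) ∧
    ((∃ a ∈ A, cv a = c) → i + 1 ≤ VC cv c) := by
  classical
  have inj : ∀ a b, a ≤ p + 1 → b ≤ p + 1 → x a = x b → a = b := fun a b ha hb hab => hinj ha hb hab
  have hd : Disjoint ((Finset.Icc 1 i).image x) A1 := by
    rw [Finset.disjoint_left]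
    intro v hv hv'
    obtain ⟨k, hk, rfl⟩ := Finset.mem_image.1 hv
    rw [Finset.mem_Icc] at hk
    exact hxA k (by omega) (hA1 hv')
  have hc1 : ((Finset.Icc 1 i).image x).card = i := by
    rw [Finset.card_image_of_injOn]
    · simp
    · intro a ha b hb
      simp at ha hb
      exact inj a b (by omega) (by omega)
  have hc2 : ((Finset.range i).image x).card = i := by
    rw [Finset.card_image_of_injOn]
    · simp
    · intro a ha b hb
      simp at ha hb
      exact inj a b (by omega) (by omega)
  have h0 : x 0 ∉ (Finset.Icc 1 i).image x ∪ A1 := by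
    rw [Finset.mem_union, not_or]
    refine ⟨?_, fun hh => hxA 0 (by omega) (hA1 hh)⟩
    intro hh
    obtain ⟨k, hk, hk'⟩ := Finset.mem_image.1 hh
    rw [Finset.mem_Icc] at hk
    have := inj k 0 (by omega) (by omega) hk'
    omega
  have ht : x (p+1) ∉ (Finset.Icc 1 i).image x ∪ A1 := by
    rw [Finset.mem_union, not_or]
    refine ⟨?_, fun hh => hxA (p+1) (by omega) (hA1 hh)⟩
    intro hh
    obtain ⟨k, hk, hk'⟩ := Finset.mem_image.1 hh
    rw [Finset.mem_Icc] at hk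
    have := inj k (p+1) (by omega) (by omega) hk'
    omega
  have hW : ∀ w ∈ (Finset.Icc 1 i).image x ∪ A1, (Hc G ce c).Reachable (x 0) w := by
    intro w hw
    rcases Finset.mem_union.1 hw with hw | hw
    · obtain ⟨k, hk, rfl⟩ := Finset.mem_image.1 hw
      rw [Finset.mem_Icc] at hk
      exact left_reach hadj (by omega) h k hk.2
    · exact hr w hw
  have hU : ∀ w ∈ (Finset.range i).image x, cv w = c := by
    intro w hw
    obtain ⟨k, hk, rfl⟩ := Finset.mem_image.1 hw
    rw [Finset.mem_range] at hk
    exact (h k hk).2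
  refine ⟨?_, ?_, ?_, ?_⟩
  · have := reach_edges G ce c (x 0) _ h0 hW
    rwa [Finset.card_union_of_disjoint hd, hc1] at this
  · have := verts_le cv c _ hU
    rwa [hc2] at this
  · intro hrt
    have := reach_edges G ce c (x 0) (insert (x (p+1)) ((Finset.Icc 1 i).image x ∪ A1)) (by
      rw [Finset.mem_insert, not_or]
      refine ⟨fun hh => ?_, h0⟩
      have := inj 0 (p+1) (by omega) (by omega) hh
      omega) (by
      intro w hw
      rcases Finset.mem_insert.1 hw with rfl | hw
      · exact hrt
      · exact hW w hw)
    rwa [Finset.card_insert_of_notMem ht, Finset.card_union_of_disjoint hd, hc1] at this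
  · rintro ⟨a, ha, hac⟩
    have := verts_le cv c (insert a ((Finset.range i).image x)) (by
      intro w hw
      rcases Finset.mem_insert.1 hw with rfl | hw
      · exact hac
      · exact hU w hw)
    rwa [Finset.card_insert_of_notMem, hc2] at this
    intro hh
    obtain ⟨k, hk, rfl⟩ := Finset.mem_image.1 hh
    rw [Finset.mem_range] at hk
    exact hxA k (by omega) ha

lemma sideR (hadj : ∀ k ≤ p, G.Adj (x k) (x (k+1)))
    (hinj : Set.InjOn x (Set.Iic (p+1))) (hxA : ∀ k ≤ p + 1, x k ∉ A)
    {j c : ℕ} (hj : 1 ≤ j) (hj' : j ≤ p + 1) (h : Right ce cv x p j c)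
    (A1 : Finset V) (hA1 : A1 ⊆ A) (hr : ∀ a ∈ A1, (Hc G ce c).Reachable (x (p+1)) a) :
    (p + 1 - j) + A1.card ≤ EC G ce c ∧ (p + 1 - j) ≤ VC cv c ∧
    ((Hc G ce c).Reachable (x 0) (x (p+1)) → (p + 1 - j) + A1.card + 1 ≤ EC G ce c) ∧
    ((∃ a ∈ A, cv a = c) → (p + 1 - j) + 1 ≤ VC cv c) := by
  classical
  have inj : ∀ a b, a ≤ p + 1 → b ≤ p + 1 → x a = x b → a = b := fun a b ha hb hab => hinj ha hb hab
  have hd : Disjoint ((Finset.Ico j (p+1)).image x) A1 := by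
    rw [Finset.disjoint_left]
    intro v hv hv'
    obtain ⟨k, hk, rfl⟩ := Finset.mem_image.1 hv
    rw [Finset.mem_Ico] at hk
    exact hxA k (by omega) (hA1 hv')
  have hc1 : ((Finset.Ico j (p+1)).image x).card = p + 1 - j := by
    rw [Finset.card_image_of_injOn]
    · simp
    · intro a ha b hb
      simp at ha hb
      exact inj a b (by omega) (by omega)
  have hc2 : ((Finset.Ico j (p+1)).image (fun k => x (k+1))).card = p + 1 - j := by
    rw [Finset.card_image_of_injOn]
    · simp
    · intro a ha b hb hab
      simp at ha hb
      have := inj (a+1) (b+1) (by omega) (by omega) hab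
      omega
  have h0 : x 0 ∉ (Finset.Ico j (p+1)).image x ∪ A1 := by
    rw [Finset.mem_union, not_or]
    refine ⟨?_, fun hh => hxA 0 (by omega) (hA1 hh)⟩
    intro hh
    obtain ⟨k, hk, hk'⟩ := Finset.mem_image.1 hh
    rw [Finset.mem_Ico] at hk
    have := inj k 0 (by omega) (by omega) hk'
    omega
  have ht : x (p+1) ∉ (Finset.Ico j (p+1)).image x ∪ A1 := by
    rw [Finset.mem_union, not_or]
    refine ⟨?_, fun hh => hxA (p+1) (by omega) (hA1 hh)⟩
    intro hh
    obtain ⟨k, hk, hk'⟩ := Finset.mem_image.1 hh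
    rw [Finset.mem_Ico] at hk
    have := inj k (p+1) (by omega) (by omega) hk'
    omega
  have hW : ∀ w ∈ (Finset.Ico j (p+1)).image x ∪ A1, (Hc G ce c).Reachable (x (p+1)) w := by
    intro w hw
    rcases Finset.mem_union.1 hw with hw | hw
    · obtain ⟨k, hk, rfl⟩ := Finset.mem_image.1 hw
      rw [Finset.mem_Ico] at hk
      exact right_reach hadj h (p + 1 - k) k hk.1 (by omega)
    · exact hr w hw
  have hU : ∀ w ∈ (Finset.Ico j (p+1)).image (fun k => x (k+1)), cv w = c := by
    intro w hw
    obtain ⟨k, hk, rfl⟩ := Finset.mem_image.1 hw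
    rw [Finset.mem_Ico] at hk
    exact (h k hk.1 (by omega)).2
  refine ⟨?_, ?_, ?_, ?_⟩
  · have := reach_edges G ce c (x (p+1)) _ ht hW
    rwa [Finset.card_union_of_disjoint hd, hc1] at this
  · have := verts_le cv c _ hU
    rwa [hc2] at this
  · intro hrt
    have := reach_edges G ce c (x (p+1)) (insert (x 0) ((Finset.Ico j (p+1)).image x ∪ A1)) (by
      rw [Finset.mem_insert, not_or]
      refine ⟨fun hh => ?_, ht⟩
      have := inj (p+1) 0 (by omega) (by omega) hh
      omega) (by
      intro w hw
      rcases Finset.mem_insert.1 hw with rfl | hw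
      · exact hrt.symm
      · exact hW w hw)
    rwa [Finset.card_insert_of_notMem h0, Finset.card_union_of_disjoint hd, hc1] at this
  · rintro ⟨a, ha, hac⟩
    have := verts_le cv c (insert a ((Finset.Ico j (p+1)).image (fun k => x (k+1)))) (by
      intro w hw
      rcases Finset.mem_insert.1 hw with rfl | hw
      · exact hac
      · exact hU w hw)
    rwa [Finset.card_insert_of_notMem, hc2] at this
    intro hh
    obtain ⟨k, hk, rfl⟩ := Finset.mem_image.1 hh
    rw [Finset.mem_Ico] at hk
    exact hxA (k+1) (by omega) ha

/-- escape from the path -/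
lemma escape (h : IsTMCColoring G ce cv) (hinj : Set.InjOn x (Set.Iic (p+1)))
    (hxA : ∀ k ≤ p + 1, x k ∉ A)
    (hmid : ∀ k, 1 ≤ k → k ≤ p → ∀ y, G.Adj (x k) y → y = x (k-1) ∨ y = x (k+1))
    {i : ℕ} (hi : 1 ≤ i) (hip : i ≤ p) {a : V} (ha : a ∈ A) :
    ∃ c, (Hc G ce c).Reachable (x i) a ∧ (Left ce cv x i c ∨ Right ce cv x p i c) := by
  have hne : ∀ k ≤ p + 1, x k ≠ a := fun k hk hh => hxA k hk (hh ▸ ha)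
  obtain ⟨c, hr, hcut⟩ := tmc_cut h (hne i (by omega))
  refine ⟨c, hr, ?_⟩
  have key : ∀ k l, k < i → i ≤ l → l ≤ p →
      (ce s(x k, x (k+1)) = c ∧ cv (x k) = c) ∨ (ce s(x l, x (l+1)) = c ∧ cv (x (l+1)) = c) := by
    intro k l hk hl hlp
    obtain ⟨y, z, ⟨m, hm, rfl⟩, hz, hyz, hcol, -, hzc⟩ := hcut (x '' Set.Icc (k+1) l)
      ⟨i, ⟨by omega, by omega⟩, rfl⟩ (by
        rintro ⟨m, hm, hm'⟩
        rw [Set.mem_Icc] at hm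
        exact hne m (by omega) hm')
    rw [Set.mem_Icc] at hm
    rcases hmid m (by omega) (by omega) z hyz with rfl | rfl
    · have hmk : m = k + 1 := by
        by_contra hh
        exact hz ⟨m - 1, ⟨by omega, by omega⟩, rfl⟩
      subst hmk
      left
      simp only [Nat.add_sub_cancel] at *
      refine ⟨by rw [Sym2.eq_swap]; exact hcol, ?_⟩
      rcases hzc with hzc | hzc
      · exact absurd hzc (hne k (by omega))
      · exact hzc
    · have hmk : m = l := by
        by_contra hh
        exact hz ⟨m + 1, ⟨by omega, by omega⟩, rfl⟩
      subst hmk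
      right
      refine ⟨hcol, ?_⟩
      rcases hzc with hzc | hzc
      · exact absurd hzc (hne _ (by omega))
      · exact hzc
  by_cases hL : Left ce cv x i c
  · exact Or.inl hL
  · right
    unfold Left at hL
    push Not at hL
    obtain ⟨k, hk, hk'⟩ := hL
    intro l hl hlp
    rcases key k l hk hl hlp with h1 | h1
    · exact absurd h1.2 (hk' h1.1)
    · exact h1

/-- the pair of ends of the path -/
lemma ends (h : IsTMCColoring G ce cv) (hinj : Set.InjOn x (Set.Iic (p+1)))
    (hp : 1 ≤ p) (hxA : ∀ k ≤ p + 1, x k ∉ A)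
    (hmid : ∀ k, 1 ≤ k → k ≤ p → ∀ y, G.Adj (x k) y → y = x (k-1) ∨ y = x (k+1))
    (h0 : ∀ y, G.Adj (x 0) y → y ∈ A ∨ y = x 1) :
    ∃ c, (Hc G ce c).Reachable (x 0) (x (p+1)) ∧ 3 ≤ EC G ce c + VC cv c ∧
      ((∃ a ∈ A, cv a = c) ∨ 
       ((∀ k ≤ p, ce s(x k, x (k+1)) = c) ∧ ∀ k, 1 ≤ k → k ≤ p → cv (x k) = c)) := by
  classical
  have inj : ∀ a b, a ≤ p + 1 → b ≤ p + 1 → x a = x b → a = b := fun a b ha hb hab => hinj ha hb hab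
  have h0p : x 0 ≠ x (p+1) := fun hh => by
    have := inj 0 (p+1) (by omega) (by omega) hh
    omega
  obtain ⟨c, hr, hcut⟩ := tmc_cut h h0p
  refine ⟨c, hr, ?_, ?_⟩
  · obtain ⟨y, z, hy, hz, hyz, hcol, -, hzc⟩ := hcut {x 0} rfl (fun hh => h0p hh.symm)
    rw [Set.mem_singleton_iff] at hy
    subst hy
    have hzp : z ≠ x (p+1) := by
      rcases h0 z hyz with hh | hh
      · rintro rfl; exact hxA _ le_rfl hh
      · rintro rfl
        have := inj (p+1) 1 (by omega) (by omega) hh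
        omega
    have e := reach_edges G ce c (x 0) {z, x (p+1)} (by
      simp only [Finset.mem_insert, Finset.mem_singleton, not_or]
      exact ⟨hyz.ne, h0p⟩) (by
      intro w hw
      simp only [Finset.mem_insert, Finset.mem_singleton] at hw
      rcases hw with rfl | rfl
      · exact Adj.reachable ⟨hyz, hcol⟩
      · exact hr)
    rw [Finset.card_pair hzp] at e
    have f := verts_le cv c {z} (by
      intro w hw
      rw [Finset.mem_singleton] at hw
      subst hw
      exact hzc.resolve_left hzp)
    rw [Finset.card_singleton] at f
    omega
  · by_cases hA : ∃ a ∈ A, cv a = c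
    · exact Or.inl hA
    right
    push Not at hA
    have key : ∀ l ≤ p, ce s(x l, x (l+1)) = c ∧ (l = 0 ∨ cv (x l) = c) := by
      intro l hl
      obtain ⟨y, z, ⟨m, hm, rfl⟩, hz, hyz, hcol, hyc, hzc⟩ := hcut (x '' Set.Iic l)
        ⟨0, by simp, rfl⟩ (by
          rintro ⟨m, hm, hm'⟩
          rw [Set.mem_Iic] at hm
          have := inj m (p+1) (by omega) (by omega) hm'
          omega)
      rw [Set.mem_Iic] at hm
      have hzz : z = x (m+1) := by
        rcases Nat.eq_zero_or_pos m with rfl | hm0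
        · rcases h0 z hyz with hh | hh
          · exfalso
            rcases hzc with hzc | hzc
            · rw [hzc] at hh; exact hxA _ le_rfl hh
            · exact hA z hh hzc
          · exact hh
        · rcases hmid m hm0 (by omega) z hyz with rfl | hh
          · exact absurd ⟨m-1, by simp; omega, rfl⟩ hz
          · exact hh
      subst hzz
      have : m = l := by
        by_contra hh
        exact hz ⟨m+1, by simp; omega, rfl⟩
      subst this
      refine ⟨hcol, ?_⟩
      rcases hyc with hyc | hyc
      · exact Or.inl (inj m 0 (by omega) (by omega) hyc)
      · exact Or.inr hyc
    refine ⟨fun k hk => (key k hk).1, fun k hk hk' => ?_⟩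
    rcases (key k hk').2 with hh | hh
    · omega
    · exact hh

theorem upper (h : IsTMCColoring G ce cv) (hinj : Set.InjOn x (Set.Iic (p+1)))
    (hp : 1 ≤ p) (hA : A.Nonempty) (hxA : ∀ k ≤ p + 1, x k ∉ A)
    (hcov : ∀ v, v ∈ A ∨ ∃ k ≤ p + 1, v = x k)
    (hadj : ∀ k ≤ p, G.Adj (x k) (x (k+1)))
    (hmid : ∀ k, 1 ≤ k → k ≤ p → ∀ y, G.Adj (x k) y → y = x (k-1) ∨ y = x (k+1))
    (h0 : ∀ y, G.Adj (x 0) y → y ∈ A ∨ y = x 1)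
    (hcard : Fintype.card V = A.card + p + 2) :
    colorsUsed G ce cv + (A.card + 1 + 2 * p) ≤ G.edgeSet.ncard + Fintype.card V := by
  classical
  have inj : ∀ a b, a ≤ p + 1 → b ≤ p + 1 → x a = x b → a = b := fun a b ha hb hab => hinj ha hb hab
  obtain ⟨c₁, hc₁⟩ : ∃ c, c = ce s(x 0, x 1) := ⟨_, rfl⟩
  obtain ⟨c₂, hc₂⟩ : ∃ c, c = ce s(x p, x (p+1)) := ⟨_, rfl⟩
  have hLR : ∀ i, 1 ≤ i → i ≤ p → ∀ a ∈ A,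
      (Left ce cv x i c₁ ∧ (Hc G ce c₁).Reachable (x 0) a) ∨
      (Right ce cv x p i c₂ ∧ (Hc G ce c₂).Reachable (x (p+1)) a) := by
    intro i hi hip a ha
    obtain ⟨c, hr, hh | hh⟩ := escape h hinj hxA hmid hi hip ha
    · left
      have : c = c₁ := by rw [hc₁, (hh 0 (by omega)).1]
      subst this
      exact ⟨hh, (left_reach hadj (by omega) hh i le_rfl).trans hr⟩
    · right
      have : c = c₂ := by rw [hc₂, (hh p (by omega) le_rfl).1]
      subst this
      exact ⟨hh, (right_reach hadj hh (p+1-i) i le_rfl (by omega)).trans hr⟩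
  obtain ⟨c₃, hr3, hN3, hin⟩ := ends h hinj hp hxA hmid h0
  obtain ⟨a₀, ha₀⟩ := hA
  have hN1 : 1 ≤ EC G ce c₁ := by
    have := reach_edges G ce c₁ (x 0) {x 1} (by
      simp only [Finset.mem_singleton]; exact (hadj 0 (by omega)).ne) (by
      intro w hw
      simp only [Finset.mem_singleton] at hw
      subst hw
      exact Adj.reachable ⟨hadj 0 (by omega), hc₁.symm⟩)
    simpa using this
  have hN2 : 1 ≤ EC G ce c₂ := by
    have := reach_edges G ce c₂ (x p) {x (p+1)} (by
      simp only [Finset.mem_singleton]; exact (hadj p (by omega)).ne) (by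
      intro w hw
      simp only [Finset.mem_singleton] at hw
      subst hw
      exact Adj.reachable ⟨hadj p (by omega), hc₂.symm⟩)
    simpa using this
  -- maximal left index
  obtain ⟨i, hip, hLi, hmax⟩ : ∃ i ≤ p, Left ce cv x i c₁ ∧ (i < p → ¬ Left ce cv x (i+1) c₁) := by
    have hL0 : Left ce cv x 0 c₁ := fun k hk => absurd hk (by omega)
    refine ⟨Nat.findGreatest (fun i => Left ce cv x i c₁) p, Nat.findGreatest_le _,
      Nat.findGreatest_spec (P := fun i => Left ce cv x i c₁) (Nat.zero_le p) hL0, ?_⟩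
    intro hlt
    exact Nat.findGreatest_is_greatest (P := fun i => Left ce cv x i c₁) (Nat.lt_succ_self _) hlt
  have hA2 : i < p → Right ce cv x p (i+1) c₂ ∧ ∀ a ∈ A, (Hc G ce c₂).Reachable (x (p+1)) a := by
    intro hlt
    have : ∀ a ∈ A, Right ce cv x p (i+1) c₂ ∧ (Hc G ce c₂).Reachable (x (p+1)) a := by
      intro a ha
      rcases hLR (i+1) (by omega) (by omega) a ha with hh | hh
      · exact absurd hh.1 (hmax hlt)
      · exact hh
    exact ⟨(this a₀ ha₀).1, fun a ha => (this a ha).2⟩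
  have hRi : Right ce cv x p (i+1) c₂ := by
    rcases Nat.lt_or_ge i p with hh | hh
    · exact (hA2 hh).1
    · intro k hk hk'; omega
  have hA1 : 1 ≤ i → Right ce cv x p i c₂ ∨ ∀ a ∈ A, (Hc G ce c₁).Reachable (x 0) a := by
    intro hi
    by_cases hh : Right ce cv x p i c₂
    · exact Or.inl hh
    · right
      intro a ha
      rcases hLR i hi hip a ha with h1 | h1
      · exact h1.2
      · exact absurd h1.1 hh
  by_cases hcc : c₁ = c₂
  · -- one colour
    have hrt : (Hc G ce c₁).Reachable (x 0) (x (p+1)) := by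
      rcases Nat.lt_or_ge i p with hlt | hge
      · rcases Nat.eq_zero_or_pos i with hi0 | hi0
        · subst hi0
          have a1 : (Hc G ce c₁).Reachable (x 0) (x 1) :=
            Adj.reachable ⟨hadj 0 (by omega), hc₁.symm⟩
          have a2 := right_reach hadj hRi p 1 (by omega) (by omega)
          rw [← hcc] at a2
          exact a1.trans a2.symm
        · rcases hA1 hi0 with hh | hh
          · have a1 := left_reach hadj (by omega) hLi i le_rfl
            have a2 := right_reach hadj hh (p+1-i) i le_rfl (by omega)
            rw [← hcc] at a2
            exact a1.trans a2.symm
          · have a2 := (hA2 hlt).2 a₀ ha₀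
            rw [← hcc] at a2
            exact (hh a₀ ha₀).trans a2.symm
      · have : i = p := by omega
        subst this
        have a1 := left_reach hadj (by omega) hLi i le_rfl
        exact a1.trans (Adj.reachable ⟨hadj i le_rfl, by rw [hcc]; exact hc₂.symm⟩)
    have hall : ∀ v, (Hc G ce c₁).Reachable (x 0) v := by
      intro v
      rcases hcov v with hv | ⟨k, hk, rfl⟩
      · rcases hLR 1 le_rfl hp v hv with hh | hh
        · exact hh.2
        · rw [← hcc] at hh
          exact hrt.trans hh.2
      · rcases Nat.lt_or_ge i k with hik | hik
        · have a2 := right_reach hadj hRi (p+1-k) k (by omega) (by omega)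
          rw [← hcc] at a2
          exact hrt.trans a2
        · exact left_reach hadj (by omega) hLi k hik
    have hE := reach_edges G ce c₁ (x 0) (Finset.univ.erase (x 0)) (by simp) (fun w _ => hall w)
    rw [Finset.card_erase_of_mem (Finset.mem_univ _), Finset.card_univ] at hE
    -- vertices on the path
    obtain ⟨U, hU⟩ : ∃ U, U = (Finset.range i).image x ∪ (Finset.Ico (i+2) (p+2)).image x :=
      ⟨_, rfl⟩
    have hUx : ∀ w ∈ U, ∃ k ≤ p + 1, w = x k := by
      intro w hw
      rw [hU, Finset.mem_union, Finset.mem_image, Finset.mem_image] at hw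
      rcases hw with ⟨k, hk, rfl⟩ | ⟨k, hk, rfl⟩
      · rw [Finset.mem_range] at hk; exact ⟨k, by omega, rfl⟩
      · rw [Finset.mem_Ico] at hk; exact ⟨k, by omega, rfl⟩
    have hUc : ∀ w ∈ U, cv w = c₁ := by
      intro w hw
      rw [hU, Finset.mem_union, Finset.mem_image, Finset.mem_image] at hw
      rcases hw with ⟨k, hk, rfl⟩ | ⟨k, hk, rfl⟩
      · rw [Finset.mem_range] at hk; exact (hLi k hk).2
      · rw [Finset.mem_Ico] at hk
        have := (hRi (k-1) (by omega) (by omega)).2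
        rw [hcc, ← this]; congr 2; omega
    have hUcard : U.card = p := by
      rw [hU, ← Finset.image_union, Finset.card_image_of_injOn, Finset.card_union_of_disjoint]
      · simp; omega
      · rw [Finset.disjoint_left]; intro k; simp; omega
      · intro a ha b hb
        simp at ha hb
        exact inj a b (by omega) (by omega)
    by_cases h3 : c₃ = c₁
    · have hV : p + 1 ≤ VC cv c₁ := by
        rw [h3] at hin
        rcases hin with ⟨a, ha, hac⟩ | ⟨-, hin⟩
        · have := verts_le cv c₁ (insert a U) (by
            intro w hw
            rcases Finset.mem_insert.1 hw with rfl | hw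
            · exact hac
            · exact hUc w hw)
          rwa [Finset.card_insert_of_notMem, hUcard] at this
          intro hh
          obtain ⟨k, hk, rfl⟩ := hUx a hh
          exact hxA k hk ha
        · rcases Nat.eq_zero_or_pos i with hi0 | hi0
          · have := verts_le cv c₁ ((Finset.Icc 1 (p+1)).image x) (by
              intro w hw
              obtain ⟨k, hk, rfl⟩ := Finset.mem_image.1 hw
              rw [Finset.mem_Icc] at hk
              rcases Nat.lt_or_ge p k with hkp | hkp
              · have := (hRi p (by omega) le_rfl).2
                rw [hcc, ← this]; congr 2; omega
              · exact hin k hk.1 hkp)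
            rw [Finset.card_image_of_injOn] at this
            · simpa using this
            · intro a ha b hb
              simp at ha hb
              exact inj a b (by omega) (by omega)
          · have := verts_le cv c₁ ((Finset.range (p+1)).image x) (by
              intro w hw
              obtain ⟨k, hk, rfl⟩ := Finset.mem_image.1 hw
              rw [Finset.mem_range] at hk
              rcases Nat.eq_zero_or_pos k with hkp | hkp
              · subst hkp
                exact (hLi 0 hi0).2
              · exact hin k hkp (by omega))
            rw [Finset.card_image_of_injOn] at this
            · simpa using this
            · intro a ha b hb
              simp at ha hb
              exact inj a b (by omega) (by omega)
      have := count_colors G ce cv {c₁}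
      rw [Finset.sum_singleton] at this
      omega
    · have hV := verts_le cv c₁ U hUc
      rw [hUcard] at hV
      have := count_colors G ce cv {c₃, c₁}
      rw [Finset.sum_pair h3] at this
      omega
  · -- two colours
    have hnin : ¬ (∀ k ≤ p, ce s(x k, x (k+1)) = c₃) := by
      intro hh
      apply hcc
      rw [hc₁, hc₂, hh p le_rfl]
      exact hh 0 (by omega)
    have hin' : ∃ a ∈ A, cv a = c₃ := hin.resolve_right (fun hh => hnin hh.1)
    have gen : ∀ i j, i ≤ p → 1 ≤ j → j ≤ p + 1 → Left ce cv x i c₁ → Right ce cv x p j c₂ →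
        ∀ A1 A2, A1 ⊆ A → A2 ⊆ A → (∀ a ∈ A1, (Hc G ce c₁).Reachable (x 0) a) →
        (∀ a ∈ A2, (Hc G ce c₂).Reachable (x (p+1)) a) →
        colorsUsed G ce cv + ((2 * i + A1.card - 1) + (2 * (p + 1 - j) + A2.card - 1) + 2) ≤
        G.edgeSet.ncard + Fintype.card V := by
      intro i j hi hj hj' hL hR A1 A2 hA1 hA2 hr1 hr2
      obtain ⟨l1, l2, l3, l4⟩ := sideL hadj hinj hxA hi hL A1 hA1 hr1
      obtain ⟨r1, r2, r3, r4⟩ := sideR hadj hinj hxA hj hj' hR A2 hA2 hr2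
      by_cases h31 : c₃ = c₁
      · rw [h31] at hr3 hin' hN3
        have l3 := l3 hr3
        have l4 := l4 hin'
        have := count_colors G ce cv {c₁, c₂}
        rw [Finset.sum_pair hcc] at this
        omega
      by_cases h32 : c₃ = c₂
      · rw [h32] at hr3 hin' hN3
        have r3 := r3 hr3
        have r4 := r4 hin'
        have := count_colors G ce cv {c₁, c₂}
        rw [Finset.sum_pair hcc] at this
        omega
      · have := count_colors G ce cv {c₃, c₁, c₂}
        rw [Finset.sum_insert (by simp [h31, h32]), Finset.sum_pair hcc] at this
        omega
    have hApos : 1 ≤ A.card := Finset.card_pos.2 ⟨a₀, ha₀⟩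
    rcases Nat.lt_or_ge i p with hlt | hge
    · have hr2 := (hA2 hlt).2
      rcases Nat.eq_zero_or_pos i with hi0 | hi0
      · have := gen i (i+1) hip (by omega) (by omega) hLi hRi ∅ A (by simp) subset_rfl (by simp) hr2
        simp only [Finset.card_empty] at this
        omega
      · rcases hA1 hi0 with hh | hh
        · have := gen i i hip (by omega) (by omega) hLi hh ∅ A (by simp) subset_rfl (by simp) hr2
          simp only [Finset.card_empty] at this
          omega
        · have := gen i (i+1) hip (by omega) (by omega) hLi hRi A A subset_rfl subset_rfl hh hr2
          omega
    · have hi' : i = p := by omega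
      rcases hA1 (by omega) with hh | hh
      · have := gen i i hip (by omega) (by omega) hLi hh
          (A.filter (fun a => (Hc G ce c₁).Reachable (x 0) a))
          (A.filter (fun a => (Hc G ce c₂).Reachable (x (p+1)) a))
          (Finset.filter_subset _ _) (Finset.filter_subset _ _)
          (fun a ha => (Finset.mem_filter.1 ha).2) (fun a ha => (Finset.mem_filter.1 ha).2)
        have hu : A.card ≤ (A.filter (fun a => (Hc G ce c₁).Reachable (x 0) a)).card +
            (A.filter (fun a => (Hc G ce c₂).Reachable (x (p+1)) a)).card := by
          refine le_trans (Finset.card_le_card ?_) (Finset.card_union_le _ _)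
          intro a ha
          rw [Finset.mem_union, Finset.mem_filter, Finset.mem_filter]
          rcases hLR i (by omega) hip a ha with h1 | h1
          · exact Or.inl ⟨ha, h1.2⟩
          · exact Or.inr ⟨ha, h1.2⟩
        omega
      · have := gen i (i+1) hip (by omega) (by omega) hLi hRi A ∅ subset_rfl (by simp) hh (by simp)
        simp only [Finset.card_empty] at this
        omega

end main
end TMCaux

namespace TMCaux

lemma internal_not_leaf {V : Type*} [Fintype V] {T : SimpleGraph V} {u v x : V} (w : T.Walk u v)
    (hw : w.IsPath) (hx : x ∈ w.support.tail.dropLast) : (T.neighborSet x).ncard ≠ 1 := by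
  classical
  have hx1 : x ∈ w.support.tail := List.mem_of_mem_dropLast hx
  have hxs : x ∈ w.support := List.mem_of_mem_tail hx1
  have hnd := hw.support_nodup
  have hxu : x ≠ u := by
    rintro rfl
    rw [Walk.support_eq_cons] at hnd
    exact (List.nodup_cons.1 hnd).1 hx1
  have hxv : x ≠ v := by
    rintro rfl
    cases w with
    | nil => simp at hx
    | cons h q =>
      simp only [Walk.support_cons, List.tail_cons] at hx
      have h1 := (List.nodup_cons.1 hnd).2
      rw [← List.dropLast_append_getLast (q.support_ne_nil)] at h1
      have h2 := (List.nodup_append.1 h1).2.2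
      exact h2 _ hx _ (by simp) rfl
  have n1 : ¬ (w.takeUntil x hxs).Nil := fun h => hxu h.eq.symm
  have n2 : ¬ (w.dropUntil x hxs).Nil := fun h => hxv h.eq
  have a1 := (Walk.adj_penultimate n1).symm
  have a2 := Walk.adj_snd n2
  intro hone
  obtain ⟨z, hz⟩ := Set.ncard_eq_one.1 hone
  have b1 : (w.takeUntil x hxs).penultimate = z := by
    have : (w.takeUntil x hxs).penultimate ∈ T.neighborSet x := a1
    rw [hz] at this; exact this
  have b2 : (w.dropUntil x hxs).snd = z := by
    have : (w.dropUntil x hxs).snd ∈ T.neighborSet x := a2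
    rw [hz] at this; exact this
  have c1 : z ∈ (w.takeUntil x hxs).support := by
    rw [← b1]; exact Walk.getVert_mem_support _ _
  have c2 : z ∈ (w.dropUntil x hxs).support.tail := by
    rw [← b2]; exact Walk.snd_mem_tail_support n2
  have hsp := congrArg Walk.support (w.take_spec hxs)
  rw [Walk.support_append] at hsp
  rw [← hsp] at hnd
  exact (List.nodup_append.1 hnd).2.2 _ c1 _ c2 rfl

theorem lower {V : Type*} [Fintype V] [Nontrivial V] (G T : SimpleGraph V) (hTG : T ≤ G)
    (hT : T.IsTree) : ∃ ce cv, IsTMCColoring G ce cv ∧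
      G.edgeSet.ncard + 2 + numLeaves T ≤ colorsUsed G ce cv + Fintype.card V := by
  classical
  obtain ⟨f, hf⟩ : ∃ f : Sym2 V ⊕ V → ℕ, Function.Injective f :=
    ⟨fun z => (Fintype.equivFin _ z).val, fun a b h => by
      simpa [Fin.val_inj] using h⟩
  let ce : Sym2 V → ℕ := fun e => if e ∈ T.edgeSet then 0 else f (Sum.inl e) + 1
  let cv : V → ℕ := fun v => if (T.neighborSet v).ncard = 1 then f (Sum.inr v) + 1 else 0
  refine ⟨ce, cv, ?_, ?_⟩
  · intro u v huv
    obtain ⟨w, hw, -⟩ := hT.existsUnique_path u v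
    refine ⟨w.mapLe hTG, by simpa using hw, 0, ?_, ?_⟩
    · intro e he
      rw [Walk.edges_mapLe_eq_edges] at he
      exact if_pos (w.edges_subset_edgeSet he)
    · intro x hx
      rw [Walk.support_mapLe_eq_support] at hx
      exact if_neg (internal_not_leaf w hw hx)
  · have hTc : T.edgeFinset.card + 1 = Fintype.card V := hT.card_edgeFinset
    have hm : G.edgeSet.ncard = G.edgeFinset.card := by
      rw [← Set.ncard_coe_finset]; simp
    have hl : numLeaves T =
        (Finset.univ.filter (fun v => (T.neighborSet v).ncard = 1)).card := by
      unfold numLeaves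
      rw [← Set.ncard_coe_finset]; simp
    have hsub : T.edgeFinset ⊆ G.edgeFinset := by
      intro e he
      rw [mem_edgeFinset] at *
      exact edgeSet_mono hTG he
    have hd : (G.edgeFinset \ T.edgeFinset).card + T.edgeFinset.card = G.edgeFinset.card :=
      Finset.card_sdiff_add_card_eq_card hsub
    set L := Finset.univ.filter (fun v => (T.neighborSet v).ncard = 1) with hL
    set D := G.edgeFinset \ T.edgeFinset with hD
    have hcl : (insert 0 (D.image (fun e => f (Sum.inl e) + 1) ∪
        L.image (fun v => f (Sum.inr v) + 1)) : Finset ℕ).card ≤ colorsUsed G ce cv := by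
      unfold colorsUsed
      rw [← Set.ncard_coe_finset]
      apply Set.ncard_le_ncard _ (Set.toFinite _)
      intro c hc
      rw [Finset.mem_coe, Finset.mem_insert, Finset.mem_union, Finset.mem_image,
        Finset.mem_image] at hc
      rcases hc with rfl | ⟨e, he, rfl⟩ | ⟨v, hv, rfl⟩
      · left
        have : 1 < Fintype.card V := Fintype.one_lt_card
        obtain ⟨e, he⟩ := Finset.card_pos.1 (show 0 < T.edgeFinset.card by omega)
        exact ⟨e, mem_edgeFinset.1 (hsub he), if_pos (mem_edgeFinset.1 he)⟩
      · left
        rw [hD, Finset.mem_sdiff, mem_edgeFinset, mem_edgeFinset] at he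
        exact ⟨e, he.1, if_neg he.2⟩
      · right
        exact ⟨v, if_pos (Finset.mem_filter.1 hv).2⟩
    rw [Finset.card_insert_of_notMem, Finset.card_union_of_disjoint, Finset.card_image_of_injective,
      Finset.card_image_of_injective] at hcl
    · omega
    · intro a b h
      have := hf (Nat.succ_injective h)
      simpa using this
    · intro a b h
      have := hf (Nat.succ_injective h)
      simpa using this
    · rw [Finset.disjoint_left]
      intro c h1 h2
      obtain ⟨e, _, rfl⟩ := Finset.mem_image.1 h1
      obtain ⟨v, _, h⟩ := Finset.mem_image.1 h2
      have := hf (Nat.succ_injective h)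
      simp at this
    · simp

/-- parent function -/
def pf (n t v : ℕ) : ℕ := if v = 0 then t + 1 else if v < t then t else if v = n - 1 then t else v + 1

def Tree (n t : ℕ) : SimpleGraph (Fin n) :=
  SimpleGraph.fromRel (fun a b => (a : ℕ) ≠ t ∧ (b : ℕ) = pf n t a)

lemma pf_lt {n t v : ℕ} (h : t + 2 ≤ n) (hv : v < n) : pf n t v < n := by
  unfold pf; split_ifs <;> first | omega | grind

lemma pf_ge {n t v : ℕ} : t ≤ pf n t v := by
  unfold pf; split_ifs <;> first | omega | grind

lemma pf_ne {n t v : ℕ} (h : t + 2 ≤ n) (hv : v ≠ t) : pf n t v ≠ v := by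
  unfold pf; split_ifs <;> first | omega | grind

lemma tree_le {n t s : ℕ} (ht : 2 ≤ t) (h : t + 2 ≤ n) : Tree n t ≤ Gts n t s := by
  intro a b hab
  have ha := a.2
  have hb := b.2
  simp only [Tree, Gts, SimpleGraph.fromRel_adj, pf, ne_eq, Fin.ext_iff] at *
  refine ⟨hab.1, ?_⟩
  have := hab.2
  split_ifs at this <;> grind

lemma tree_adj {n t : ℕ} (h : t + 2 ≤ n) (a : Fin n) (ha : (a : ℕ) ≠ t) :
    (Tree n t).Adj a ⟨pf n t a, pf_lt h a.2⟩ := by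
  rw [Tree, SimpleGraph.fromRel_adj]
  refine ⟨?_, Or.inl ⟨ha, rfl⟩⟩
  intro hh
  have := congrArg Fin.val hh
  exact pf_ne h ha this.symm

lemma tree_isTree {n t : ℕ} (ht : 2 ≤ t) (h : t + 2 ≤ n) : (Tree n t).IsTree := by
  classical
  have step : ∀ (a : Fin n) (ha : (a : ℕ) ≠ t), 
      (Tree n t).Reachable a ⟨pf n t a, pf_lt h a.2⟩ := fun a ha => (tree_adj h a ha).reachable
  have hup : ∀ d (a : Fin n), t < a → (a : ℕ) + d = n - 1 → 
      (Tree n t).Reachable a ⟨t, by omega⟩ := by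
    intro d
    induction d with
    | zero =>
      intro a ha had
      have := step a (by omega)
      have e : pf n t a = t := by unfold pf; split_ifs <;> first | omega | grind
      simpa only [e] using this
    | succ d ih =>
      intro a ha had
      have := step a (by omega)
      have e : pf n t a = a + 1 := by unfold pf; split_ifs <;> first | omega | grind
      simp only [e] at this
      exact this.trans (ih _ (by simp; omega) (by simp; omega))
  have hall : ∀ a : Fin n, (Tree n t).Reachable a ⟨t, by omega⟩ := by
    intro a
    have ha := a.2
    rcases Nat.lt_trichotomy a t with hlt | heq | hgt
    · have := step a (by omega)
      by_cases h0 : (a : ℕ) = 0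
      · have e : pf n t a = t + 1 := by unfold pf; split_ifs <;> first | omega | grind
        simp only [e] at this
        exact this.trans (hup (n - 1 - (t + 1)) _ (by simp) (by simp; omega))
      · have e : pf n t a = t := by unfold pf; split_ifs <;> first | omega | grind
        simpa only [e] using this
    · have : a = ⟨t, by omega⟩ := Fin.ext heq
      rw [this]
    · exact hup (n - 1 - a) a hgt (by omega)
  have hconn : (Tree n t).Connected := by
    haveI : Nonempty (Fin n) := ⟨⟨0, by omega⟩⟩
    exact ⟨fun a b => (hall a).trans (hall b).symm⟩
  rw [isTree_iff_connected_and_card]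
  refine ⟨hconn, le_antisymm ?_ hconn.card_vert_le_card_edgeSet_add_one⟩
  have hsub : (Tree n t).edgeSet ⊆ (((Finset.univ.erase (⟨t, by omega⟩ : Fin n)).image
      (fun a => s(a, (⟨pf n t a, pf_lt h a.2⟩ : Fin n)))) : Finset (Sym2 (Fin n))) := by
    intro e
    induction e with
    | _ a b =>
      intro hab
      rw [mem_edgeSet, Tree, SimpleGraph.fromRel_adj] at hab
      rw [Finset.mem_coe, Finset.mem_image]
      rcases hab.2 with ⟨h1, h2⟩ | ⟨h1, h2⟩
      · refine ⟨a, by simp [Fin.ext_iff, h1], ?_⟩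
        rw [Sym2.eq_iff]
        exact Or.inl ⟨rfl, Fin.ext h2.symm⟩
      · refine ⟨b, by simp [Fin.ext_iff, h1], ?_⟩
        rw [Sym2.eq_iff]
        exact Or.inr ⟨rfl, Fin.ext h2.symm⟩
  have h1 := Set.ncard_le_ncard hsub (Set.toFinite _)
  rw [Set.ncard_coe_finset] at h1
  have h2 := h1.trans Finset.card_image_le
  rw [Finset.card_erase_of_mem (Finset.mem_univ _), Finset.card_univ, Fintype.card_fin] at h2
  rw [Nat.card_coe_set_eq, Nat.card_eq_fintype_card, Fintype.card_fin]
  omega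

lemma tree_leaves {n t : ℕ} (h : t + 2 ≤ n) : t ≤ numLeaves (Tree n t) := by
  classical
  unfold numLeaves
  have : (Set.range (fun i : Fin t => (⟨i, by omega⟩ : Fin n))).ncard = t := by
    rw [← Set.image_univ, Set.ncard_image_of_injective]
    · rw [Set.ncard_univ, Nat.card_eq_fintype_card, Fintype.card_fin]
    · intro a b hab
      simpa [Fin.ext_iff] using hab
  calc t = _ := this.symm
    _ ≤ _ := Set.ncard_le_ncard (by
      rintro _ ⟨i, rfl⟩
      have hi := i.2
      rw [Set.mem_setOf_eq, Set.ncard_eq_one]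
      refine ⟨⟨pf n t i, pf_lt h (by omega)⟩, ?_⟩
      ext w
      rw [mem_neighborSet, Set.mem_singleton_iff]
      constructor
      · intro hw
        rw [Tree, SimpleGraph.fromRel_adj] at hw
        rcases hw.2 with ⟨_, h2⟩ | ⟨_, h2⟩
        · exact Fin.ext h2
        · exfalso
          have := @pf_ge n t w
          simp only at h2
          omega
      · rintro rfl
        exact tree_adj h ⟨i, by omega⟩ (by simp; omega)) (Set.toFinite _)

/-- the path -/
def xf (n t k : ℕ) : ℕ := if k = 0 then 0 else if k < n - t then t + k else t

lemma xf_lt {n t k : ℕ} (h : t + 2 ≤ n) : xf n t k < n := by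
  unfold xf; split_ifs <;> first | omega | grind

lemma upper_Gts {n t s : ℕ} (ht : 2 ≤ t) (h : t + 2 ≤ n) {ce : Sym2 (Fin n) → ℕ} {cv : Fin n → ℕ}
    (hc : IsTMCColoring (Gts n t s) ce cv) :
    colorsUsed (Gts n t s) ce cv + n ≤ (Gts n t s).edgeSet.ncard + 2 + t := by
  classical
  have hAc : (Finset.univ.filter (fun v : Fin n => 1 ≤ (v : ℕ) ∧ (v : ℕ) < t)).card = t - 1 := by
    rw [← Finset.card_map Fin.valEmbedding]
    have : (Finset.univ.filter (fun v : Fin n => 1 ≤ (v : ℕ) ∧ (v : ℕ) < t)).map Fin.valEmbedding =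
        Finset.Ico 1 t := by
      ext k
      simp only [Finset.mem_map, Finset.mem_filter, Finset.mem_univ, true_and, Finset.mem_Ico,
        Fin.valEmbedding_apply]
      constructor
      · rintro ⟨a, ha, rfl⟩; exact ha
      · intro hk; exact ⟨⟨k, by omega⟩, hk, rfl⟩
    rw [this, Nat.card_Ico]
  have := upper (x := fun k => (⟨xf n t k, xf_lt h⟩ : Fin n)) (p := n - t - 1)
    (A := Finset.univ.filter (fun v : Fin n => 1 ≤ (v : ℕ) ∧ (v : ℕ) < t)) hc ?_ (by omega)
    ?_ ?_ ?_ ?_ ?_ ?_ ?_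
  · rw [hAc, Fintype.card_fin] at this
    omega
  · intro a ha b hb hab
    simp only [Set.mem_Iic] at ha hb
    simp only [Fin.mk.injEq, xf] at hab
    split_ifs at hab <;> omega
  · exact ⟨⟨1, by omega⟩, by simp; omega⟩
  · intro k hk
    simp only [Finset.mem_filter, Finset.mem_univ, true_and, xf]
    split_ifs <;> first | omega | grind
  · intro v
    have hv := v.2
    simp only [Finset.mem_filter, Finset.mem_univ, true_and]
    by_cases h1 : 1 ≤ (v : ℕ) ∧ (v : ℕ) < t
    · exact Or.inl h1
    right
    by_cases h0 : (v : ℕ) = 0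
    · refine ⟨0, by omega, ?_⟩
      apply Fin.ext
      simp [xf, h0]
    by_cases h2 : (v : ℕ) = t
    · refine ⟨n - t - 1 + 1, by omega, ?_⟩
      apply Fin.ext
      simp only [xf]
      split_ifs <;> first | omega | grind
    · refine ⟨v - t, by omega, ?_⟩
      apply Fin.ext
      simp only [xf]
      split_ifs <;> first | omega | grind
  · intro k hk
    simp only [Gts, SimpleGraph.fromRel_adj, xf, ne_eq, Fin.ext_iff]
    split_ifs <;> first | omega | grind
  · intro k hk hk' y hy
    have hy2 := y.2
    simp only [Gts, SimpleGraph.fromRel_adj, xf, ne_eq, Fin.ext_iff] at hy ⊢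
    have e1 : k ≠ 0 := by omega
    have e2 : k < n - t := by omega
    simp only [e1, e2, if_true, if_false] at hy
    split_ifs <;> first | omega | grind
  · intro y hy
    have hy2 := y.2
    simp only [Gts, SimpleGraph.fromRel_adj, xf, ne_eq, Fin.ext_iff, Finset.mem_filter,
      Finset.mem_univ, true_and] at hy ⊢
    simp only [if_true] at hy
    split_ifs <;> first | omega | grind
  · rw [hAc, Fintype.card_fin]; omega

/-- adjacency for `i < j` -/
def R (n t s i j : ℕ) : Prop :=
  (1 ≤ i ∧ j ≤ t) ∨ (i = 0 ∧ s < j ∧ j < t) ∨ (i = 0 ∧ j = t + 1) ∨ (t + 1 ≤ i ∧ j = i + 1) ∨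
    (i = t ∧ j = n - 1)

lemma adj_iff {n t s : ℕ} (ht : 2 ≤ t) (h : t + 2 ≤ n) (hs : s ≤ t - 1) (i j : Fin n) (hij : i < j) :
    (Gts n t s).Adj i j ↔ R n t s i j := by
  have hi := i.2
  have hj := j.2
  rw [Fin.lt_def] at hij
  simp only [Gts, SimpleGraph.fromRel_adj, R, ne_eq, Fin.ext_iff]
  omega

open Classical in
lemma edge_count {n t s : ℕ} (ht : 2 ≤ t) (h : t + 2 ≤ n) (hs : s ≤ t - 1) :
    (Gts n t s).edgeSet.ncard + 1 + s = n + t.choose 2 := by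
  set P : Finset (Σ _ : ℕ, ℕ) := (Finset.range n).sigma
    (fun j => (Finset.range j).filter (fun i => R n t s i j)) with hP
  have hcard : P.card = (Gts n t s).edgeSet.ncard := by
    have : (Gts n t s).edgeSet.ncard = (Gts n t s).edgeFinset.card := by
      rw [← Set.ncard_coe_finset]; simp
    rw [this]
    have hmem : ∀ a ∈ P, a.1 < n ∧ a.2 < a.1 ∧ R n t s a.2 a.1 := by
      intro a ha
      simpa [hP] using ha
    refine Finset.card_bij (fun a ha => s((⟨a.2, by have := hmem a ha; omega⟩ : Fin n),
      ⟨a.1, (hmem a ha).1⟩)) ?_ ?_ ?_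
    · intro a ha
      rw [mem_edgeFinset, mem_edgeSet, adj_iff ht h hs]
      · exact (hmem a ha).2.2
      · exact (hmem a ha).2.1
    · rintro ⟨a1, a2⟩ ha ⟨b1, b2⟩ hb hab
      have ha' := hmem _ ha
      have hb' := hmem _ hb
      simp only [Sym2.eq_iff, Fin.mk.injEq] at hab ha' hb'
      obtain ⟨h1, h2⟩ : a1 = b1 ∧ a2 = b2 := by omega
      subst h1; subst h2; rfl
    · intro e
      induction e with
      | _ a b =>
        intro hab
        rw [mem_edgeFinset, mem_edgeSet] at hab
        rcases lt_trichotomy a b with hlt | heq | hgt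
        · refine ⟨⟨b, a⟩, ?_, rfl⟩
          simp only [hP, Finset.mem_sigma, Finset.mem_range, Finset.mem_filter]
          exact ⟨b.2, hlt, (adj_iff ht h hs a b hlt).1 hab⟩
        · exact absurd heq hab.ne
        · refine ⟨⟨a, b⟩, ?_, Sym2.eq_swap⟩
          simp only [hP, Finset.mem_sigma, Finset.mem_range, Finset.mem_filter]
          exact ⟨a.2, hgt, (adj_iff ht h hs b a hgt).1 hab.symm⟩
  rw [← hcard, hP, Finset.card_sigma]
  set F : ℕ → ℕ := fun j => ((Finset.range j).filter (fun i => R n t s i j)).card with hF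
  change ∑ j ∈ Finset.range n, F j + 1 + s = _
  have f1 : ∀ j < t, F j + (if 1 ≤ j ∧ j ≤ s then 1 else 0) = j := by
    intro j hj
    split_ifs with hh
    · have : (Finset.range j).filter (fun i => R n t s i j) = Finset.Ico 1 j := by
        ext i; simp only [Finset.mem_filter, Finset.mem_range, Finset.mem_Ico, R]; grind
      simp only [hF, this, Nat.card_Ico]; omega
    · have : (Finset.range j).filter (fun i => R n t s i j) = Finset.range j := by
        ext i; simp only [Finset.mem_filter, Finset.mem_range, R]; grind
      simp only [hF, this, Finset.card_range]; omega
  have f2 : F t = t - 1 := by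
    have : (Finset.range t).filter (fun i => R n t s i t) = Finset.Ico 1 t := by
      ext i; simp only [Finset.mem_filter, Finset.mem_range, Finset.mem_Ico, R]; grind
    simp only [hF, this, Nat.card_Ico]
  have f3 : ∀ j ∈ Finset.Ico (t+1) (n-1), F j = 1 := by
    intro j hj
    rw [Finset.mem_Ico] at hj
    have : (Finset.range j).filter (fun i => R n t s i j) = {if j = t + 1 then 0 else j - 1} := by
      ext i; simp only [Finset.mem_filter, Finset.mem_range, Finset.mem_singleton, R]
      split_ifs <;> first | omega | grind
    simp only [hF, this, Finset.card_singleton]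
  have f4 : F (n-1) = 2 := by
    have : (Finset.range (n-1)).filter (fun i => R n t s i (n-1)) =
        {(if n - 1 = t + 1 then 0 else n - 2), t} := by
      ext i; simp only [Finset.mem_filter, Finset.mem_range, Finset.mem_singleton,
        Finset.mem_insert, R]
      split_ifs <;> first | omega | grind
    simp only [hF, this]
    rw [Finset.card_pair]
    split_ifs <;> first | omega | grind
  have s1 : ∑ j ∈ Finset.range t, F j + s = t.choose 2 := by
    rw [Nat.choose_two_right, ← Finset.sum_range_id]
    have : ∑ j ∈ Finset.range t, (if 1 ≤ j ∧ j ≤ s then 1 else 0) = s := by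
      rw [← Finset.card_filter]
      have : (Finset.range t).filter (fun j => 1 ≤ j ∧ j ≤ s) = Finset.Icc 1 s := by
        ext i; simp only [Finset.mem_filter, Finset.mem_range, Finset.mem_Icc]; omega
      rw [this, Nat.card_Icc]; omega
    conv_lhs => rw [← this]
    rw [← Finset.sum_add_distrib]
    apply Finset.sum_congr rfl
    intro j hj
    exact f1 j (Finset.mem_range.1 hj)
  have s2 : ∑ j ∈ Finset.Ico (t+1) (n-1), F j = n - 1 - (t + 1) := by
    rw [Finset.sum_congr rfl f3]; simp
  have s3 : ∑ j ∈ Finset.range n, F j = ∑ j ∈ Finset.range t, F j + F t +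
      ∑ j ∈ Finset.Ico (t+1) (n-1), F j + F (n-1) := by
    rw [← Finset.sum_range_succ, Finset.sum_range_add_sum_Ico _ (by omega), ← Finset.sum_range_succ]
    congr 2; omega
  omega

end TMCaux

theorem stmt11 (n t s : ℕ) (ht2 : 2 ≤ t) (htn : t ≤ n - 2) (hs : s ≤ t - 1) :
    (Gts n t s).edgeSet.ncard = n + t.choose 2 - 1 - s ∧
    maxLeaves (Gts n t s) = t ∧
    (tmc (Gts n t s) : ℤ) =
      ((Gts n t s).edgeSet.ncard : ℤ) - (n : ℤ) + 2 + (maxLeaves (Gts n t s) : ℤ) := by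
  have h : t + 2 ≤ n := by omega
  haveI : Nontrivial (Fin n) := Fin.nontrivial_iff_two_le.2 (by omega)
  have hm := TMCaux.edge_count ht2 h hs
  have hup : ∀ ce cv, IsTMCColoring (Gts n t s) ce cv →
      colorsUsed (Gts n t s) ce cv + n ≤ (Gts n t s).edgeSet.ncard + 2 + t :=
    fun ce cv hc => TMCaux.upper_Gts ht2 h hc
  have hleaf : ∀ T : SimpleGraph (Fin n), T ≤ Gts n t s → T.IsTree → numLeaves T ≤ t := by
    intro T hT hT'
    obtain ⟨ce, cv, hc, hk⟩ := TMCaux.lower _ T hT hT'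
    have := hup ce cv hc
    rw [Fintype.card_fin] at hk
    omega
  have hml : maxLeaves (Gts n t s) = t := by
    unfold maxLeaves
    apply le_antisymm
    · refine csSup_le ⟨_, _, TMCaux.tree_le ht2 h, TMCaux.tree_isTree ht2 h, rfl⟩ ?_
      rintro k ⟨T, hT, hT', rfl⟩
      exact hleaf T hT hT'
    · refine (TMCaux.tree_leaves h).trans (le_csSup ⟨t, ?_⟩
        ⟨_, TMCaux.tree_le ht2 h, TMCaux.tree_isTree ht2 h, rfl⟩)
      rintro k ⟨T, hT, hT', rfl⟩
      exact hleaf T hT hT'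
  refine ⟨by omega, hml, ?_⟩
  rw [hml]
  obtain ⟨ce, cv, hc, hk⟩ := TMCaux.lower _ _ (TMCaux.tree_le (s := s) ht2 h)
    (TMCaux.tree_isTree ht2 h)
  rw [Fintype.card_fin] at hk
  have hl := TMCaux.tree_leaves h
  have h1 : colorsUsed (Gts n t s) ce cv ≤ tmc (Gts n t s) := by
    refine le_csSup ⟨(Gts n t s).edgeSet.ncard + 2 + t, ?_⟩ ⟨ce, cv, hc, rfl⟩
    rintro k ⟨ce, cv, hc, rfl⟩
    have := hup ce cv hc
    omega
  have h2 : tmc (Gts n t s) ≤ (Gts n t s).edgeSet.ncard + 2 + t - n := by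
    refine csSup_le ⟨_, ce, cv, hc, rfl⟩ ?_
    rintro k ⟨ce, cv, hc, rfl⟩
    have := hup ce cv hc
    omega
  have h3 := hup ce cv hc
  omega
end
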